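/- Let (X_{ij})_{1≤i≤j≤n} (for each n) be centered jointly Gaussian with unit variances, and suppose that for some fixed τ > 4 and C > 0 one has |E[X_{ij} X_{i'j'}]| ≤ C/(n (log n)^τ) for all distinct index pairs and all n ≥ 2. Then for the associated symmetric matrix X_n, the largest eigenvalue λ₁(n^{-1/2} X_n) converges to 2 almost surely as n → ∞. -/

import Mathlib

open MeasureTheory ProbabilityTheory Filter Topology

noncomputable section

/-- The largest eigenvalue of a real symmetric matrix, realised as the supremum of its set
of real eigenvalues. -/
def lam1 {n : ℕ} (A : Matrix (Fin n) (Fin n) ℝ) : ℝ :=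
  sSup {t : ℝ | ∃ v : Fin n → ℝ, v ≠ 0 ∧ A.mulVec v = t • v}

/-- A finite family of real random variables is a centered (jointly) Gaussian vector:
every linear combination of the coordinates has a centered Gaussian law. -/
def IsCenteredGaussianVec {Ω : Type*} [MeasureSpace Ω] {ι : Type*} [Fintype ι]
    (X : ι → Ω → ℝ) : Prop :=
  (∀ i, Measurable (X i)) ∧
    ∀ c : ι → ℝ, ∃ v : NNReal,
      Measure.map (fun ω => ∑ i, c i * X i ω) (volume : Measure Ω) = gaussianReal 0 v

/-- Covariance of two real random variables. -/
def pcov {Ω : Type*} [MeasureSpace Ω] (W V : Ω → ℝ) : ℝ :=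
  (∫ ω, W ω * V ω) - (∫ ω, W ω) * ∫ ω, V ω

/-- Variance of a real random variable. -/
def pvar {Ω : Type*} [MeasureSpace Ω] (W : Ω → ℝ) : ℝ := pcov W W

/-- The correlated Gaussian model with parameter `ε` and constant `C`: for each `n`,
`X n` is a random symmetric `n × n` matrix whose entries `(X_{ij})_{i ≤ j}` form a centered
Gaussian vector with unit variances and pairwise correlations bounded by `C * n ^ (-(1+ε))`. -/
structure CorrGaussian (Ω : Type*) [MeasureSpace Ω]
    (X : (n : ℕ) → Ω → Matrix (Fin n) (Fin n) ℝ) (C ε : ℝ) : Prop where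
  symm : ∀ n ω, (X n ω).IsSymm
  gauss : ∀ n, IsCenteredGaussianVec fun p : Fin n × Fin n => fun ω => X n ω p.1 p.2
  var_one : ∀ n, ∀ i j : Fin n, ∫ ω, (X n ω i j) ^ 2 = 1
  corr_le : ∀ n, ∀ i j i' j' : Fin n, ¬((i, j) = (i', j') ∨ (i, j) = (j', i')) →
    |∫ ω, X n ω i j * X n ω i' j'| ≤ C * (n : ℝ) ^ (-(1 + ε))

/-- The all-ones `n × n` matrix `𝟙𝟙ᵀ`. -/
def onesMat (n : ℕ) : Matrix (Fin n) (Fin n) ℝ := Matrix.of fun _ _ => 1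

/-- The operator (spectral) norm of a real matrix, i.e. the norm of the induced map on
Euclidean space. -/
def opNorm {n : ℕ} (A : Matrix (Fin n) (Fin n) ℝ) : ℝ :=
  ‖(Matrix.toEuclideanLin A).toContinuousLinearMap‖

/-- `T n = O_P(a n)`: for every `δ > 0` there are `M > 0` and `n₀` such that
`P(|T n| > M * a n) ≤ δ` for all `n ≥ n₀`. -/
def IsBigOP {Ω : Type*} [MeasureSpace Ω] (T : ℕ → Ω → ℝ) (a : ℕ → ℝ) : Prop :=
  ∀ δ : ℝ, 0 < δ → ∃ M : ℝ, 0 < M ∧ ∃ n₀ : ℕ, ∀ n ≥ n₀,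
    (volume {ω | M * a n < |T n ω|}).toReal ≤ δ

/-- The sparse Rademacher(p) law `p δ_{-1} + (1 - 2p) δ_0 + p δ_1`. -/
def sparseRademacher (p : ℝ) : Measure ℝ :=
  ENNReal.ofReal p • Measure.dirac (-1) + ENNReal.ofReal (1 - 2 * p) • Measure.dirac 0 +
    ENNReal.ofReal p • Measure.dirac 1

end

section Aux

section PartA
open MeasureTheory ProbabilityTheory Filter Topology
open scoped Matrix.Norms.L2Operator

/-- continuous with polynomial growth -/
def PG {W E : Type*} [NormedAddCommGroup W] [NormedAddCommGroup E] (f : W → E) : Prop :=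
  Continuous f ∧ ∃ (C : ℝ) (k : ℕ), 0 ≤ C ∧ ∀ x, ‖f x‖ ≤ C * (1 + ‖x‖) ^ k

namespace PG
variable {W E F : Type*} [NormedAddCommGroup W] [NormedAddCommGroup E] [NormedAddCommGroup F]

theorem continuous {f : W → E} (hf : PG f) : Continuous f := And.left hf

theorem const (c : E) : PG (fun _ : W => c) :=
  ⟨continuous_const, ‖c‖, 0, norm_nonneg _, fun x => by simp⟩

theorem of_le_mul {f : W → E} (hf : Continuous f) (C : ℝ) (hC : 0 ≤ C)
    (h : ∀ x, ‖f x‖ ≤ C * ‖x‖) : PG f :=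
  ⟨hf, C, 1, hC, fun x => (h x).trans (by
    rw [pow_one]; exact mul_le_mul_of_nonneg_left (by linarith) hC)⟩

theorem id : PG (fun x : W => x) := of_le_mul continuous_id 1 zero_le_one (by simp)

theorem fst {V : Type*} [NormedAddCommGroup V] : PG (fun x : W × V => x.1) :=
  of_le_mul continuous_fst 1 zero_le_one (fun x => by simpa using norm_fst_le x)

theorem snd {V : Type*} [NormedAddCommGroup V] : PG (fun x : W × V => x.2) :=
  of_le_mul continuous_snd 1 zero_le_one (fun x => by simpa using norm_snd_le x)

theorem clm [NormedSpace ℝ E] [NormedSpace ℝ F] {f : W → E} (hf : PG f) (L : E →L[ℝ] F) :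
    PG (fun x => L (f x)) := by
  obtain ⟨hc, C, k, hC, h⟩ := hf
  refine ⟨L.continuous.comp hc, ‖L‖ * C, k, by positivity, fun x => ?_⟩
  calc ‖L (f x)‖ ≤ ‖L‖ * ‖f x‖ := L.le_opNorm _
    _ ≤ ‖L‖ * (C * (1 + ‖x‖) ^ k) := mul_le_mul_of_nonneg_left (h x) (norm_nonneg _)
    _ = _ := by ring

theorem add {f g : W → E} (hf : PG f) (hg : PG g) : PG (fun x => f x + g x) := by
  obtain ⟨hc, C, k, hC, h⟩ := hf
  obtain ⟨hc', C', k', hC', h'⟩ := hg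
  refine ⟨hc.add hc', C + C', k + k', by positivity, fun x => ?_⟩
  have h1 : (1:ℝ) ≤ 1 + ‖x‖ := by linarith [norm_nonneg x]
  calc ‖f x + g x‖ ≤ ‖f x‖ + ‖g x‖ := norm_add_le _ _
    _ ≤ C * (1 + ‖x‖) ^ k + C' * (1 + ‖x‖) ^ k' := add_le_add (h x) (h' x)
    _ ≤ C * (1 + ‖x‖) ^ (k + k') + C' * (1 + ‖x‖) ^ (k + k') := by
        gcongr <;> first | exact h1 | omega
    _ = _ := by ring

theorem neg {f : W → E} (hf : PG f) : PG (fun x => - f x) := by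
  obtain ⟨hc, C, k, hC, h⟩ := hf
  exact ⟨hc.neg, C, k, hC, fun x => by simpa using h x⟩

theorem sub {f g : W → E} (hf : PG f) (hg : PG g) : PG (fun x => f x - g x) := by
  simpa [sub_eq_add_neg] using hf.add hg.neg

theorem norm {f : W → E} (hf : PG f) : PG (fun x => ‖f x‖) := by
  obtain ⟨hc, C, k, hC, h⟩ := hf
  exact ⟨hc.norm, C, k, hC, fun x => by simpa using h x⟩

theorem sum {ι : Type*} (s : Finset ι) {f : ι → W → E} (hf : ∀ i ∈ s, PG (f i)) :
    PG (fun x => ∑ i ∈ s, f i x) := by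
  classical
  induction s using Finset.induction_on with
  | empty => simpa using const (0 : E)
  | insert a s ha ih =>
    simp only [Finset.sum_insert ha]
    exact (hf a (by simp)).add (ih fun i hi => hf i (by simp [hi]))

theorem comp_clm {V : Type*} [NormedAddCommGroup V] [NormedSpace ℝ W] [NormedSpace ℝ V]
    {f : W → E} (hf : PG f) (L : V →L[ℝ] W) : PG (fun x => f (L x)) := by
  obtain ⟨hc, C, k, hC, h⟩ := hf
  refine ⟨hc.comp L.continuous, C * (1 + ‖L‖) ^ k, k, by positivity, fun x => (h _).trans ?_⟩
  rw [mul_assoc, ← mul_pow]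
  gcongr
  have := L.le_opNorm x
  nlinarith [norm_nonneg x, norm_nonneg L]

theorem mul {R : Type*} [NormedRing R] {f g : W → R} (hf : PG f) (hg : PG g) :
    PG (fun x => f x * g x) := by
  obtain ⟨hc, C, k, hC, h⟩ := hf
  obtain ⟨hc', C', k', hC', h'⟩ := hg
  refine ⟨hc.mul hc', C * C', k + k', by positivity, fun x => ?_⟩
  calc ‖f x * g x‖ ≤ ‖f x‖ * ‖g x‖ := norm_mul_le _ _
    _ ≤ (C * (1 + ‖x‖) ^ k) * (C' * (1 + ‖x‖) ^ k') := by
        have := h x; have := h' x; gcongr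
    _ = _ := by ring

theorem pow {R : Type*} [NormedRing R] {f : W → R} (hf : PG f) (m : ℕ) :
    PG (fun x => f x ^ m) := by
  induction m with
  | zero =>
    simp only [pow_zero]
    exact PG.const (1 : R)
  | succ m ih =>
    simp only [pow_succ]
    exact PG.mul ih hf

theorem smul_const [NormedSpace ℝ E] {f : W → E} (hf : PG f) (c : ℝ) : PG (fun x => c • f x) := by
  obtain ⟨hc, C, k, hC, h⟩ := hf
  refine ⟨hc.const_smul c, |c| * C, k, by positivity, fun x => ?_⟩
  rw [norm_smul, Real.norm_eq_abs, mul_assoc]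
  exact mul_le_mul_of_nonneg_left (h x) (abs_nonneg c)

theorem integrable [MeasurableSpace W] [BorelSpace W] [NormedSpace ℝ W]
    [SecondCountableTopology W] [CompleteSpace W]
    {f : W → E} (hf : PG f) (ν : Measure W) [IsGaussian ν] : Integrable f ν := by
  obtain ⟨hc, C, k, hC, h⟩ := hf
  have hm : AEStronglyMeasurable f ν := by
    have : SecondCountableTopologyEither W E := inferInstance
    exact hc.aestronglyMeasurable
  have hid : MemLp (_root_.id : W → W) (k : ENNReal) ν :=
    IsGaussian.memLp_id ν (k : ENNReal) (ENNReal.natCast_ne_top k)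
  have h1 : MemLp (fun x : W => 1 + ‖x‖) (k : ENNReal) ν :=
    (memLp_const (1:ℝ)).add hid.norm
  have h2 : Integrable (fun x : W => C * (1 + ‖x‖) ^ k) ν := by
    have := h1.integrable_norm_pow'
    refine (Integrable.const_mul this C).congr (Eventually.of_forall fun x => ?_)
    have hx : (0:ℝ) ≤ 1 + ‖x‖ := by positivity
    simp only [Real.norm_eq_abs, abs_of_nonneg hx]
  exact h2.mono' hm (Eventually.of_forall h)

end PG

end PartA

section PartA2
open MeasureTheory ProbabilityTheory Filter Topology
open scoped Matrix.Norms.L2Operator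

section Rot
set_option linter.unusedSectionVars false
variable {W E : Type*} [NormedAddCommGroup W] [NormedSpace ℝ W] [MeasurableSpace W] [BorelSpace W]
    [SecondCountableTopology W] [CompleteSpace W]
    [NormedAddCommGroup E] [NormedSpace ℝ E] [CompleteSpace E]

/-- rotation of a pair -/
noncomputable def rotp (θ : ℝ) (z : W × W) : W × W :=
  (Real.cos θ • z.1 + Real.sin θ • z.2, -Real.sin θ • z.1 + Real.cos θ • z.2)

theorem rotp_eq (θ : ℝ) (z : W × W) : rotp θ z = ContinuousLinearMap.rotation (E := W) θ z := by
  simp [rotp, ContinuousLinearMap.rotation_apply]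

theorem rotp_continuous : Continuous (fun p : ℝ × (W × W) => rotp p.1 p.2) := by
  unfold rotp; fun_prop

theorem rotp_continuous_right (t : ℝ) : Continuous (fun z : W × W => rotp t z) := by
  unfold rotp; fun_prop

theorem rotp_continuous_left (z : W × W) : Continuous (fun t : ℝ => rotp t z) := by
  unfold rotp; fun_prop

theorem rotp_continuous' : Continuous (fun p : (W × W) × ℝ => rotp p.2 p.1) := by
  unfold rotp; fun_prop

theorem rotp_norm_le (θ : ℝ) (z : W × W) : ‖rotp θ z‖ ≤ 2 * ‖z‖ := by
  have h1 := norm_fst_le z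
  have h2 := norm_snd_le z
  have hc := Real.abs_cos_le_one θ
  have hs := Real.abs_sin_le_one θ
  unfold rotp
  rw [Prod.norm_mk]
  apply max_le
  · refine (norm_add_le _ _).trans ?_
    rw [norm_smul, norm_smul, Real.norm_eq_abs, Real.norm_eq_abs]
    nlinarith [norm_nonneg z.1, norm_nonneg z.2, abs_nonneg (Real.cos θ), abs_nonneg (Real.sin θ)]
  · refine (norm_add_le _ _).trans ?_
    rw [norm_smul, norm_smul, Real.norm_eq_abs, Real.norm_eq_abs, abs_neg]
    nlinarith [norm_nonneg z.1, norm_nonneg z.2, abs_nonneg (Real.cos θ), abs_nonneg (Real.sin θ)]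

theorem integral_rotp (ν : Measure W) [IsGaussian ν] (h0 : ∫ x, x ∂ν = 0) {f : W × W → E}
    (hf : Continuous f) (θ : ℝ) :
    ∫ z, f (rotp θ z) ∂(ν.prod ν) = ∫ z, f z ∂(ν.prod ν) := by
  have h := IsGaussian.map_rotation_eq_self (μ := ν) (by simpa using h0) θ
  have hm : AEMeasurable (ContinuousLinearMap.rotation (E := W) θ) (ν.prod ν) :=
    (ContinuousLinearMap.continuous _).measurable.aemeasurable
  conv_rhs => rw [← h]
  rw [integral_map hm (hf.aestronglyMeasurable)]
  simp only [rotp_eq]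

theorem PG.rotp_bound {f : W × W → E} (hf : PG f) :
    ∃ g : W × W → ℝ, PG g ∧ ∀ θ z, ‖f (rotp θ z)‖ ≤ g z := by
  obtain ⟨hc, C, k, hC, h⟩ := hf
  refine ⟨fun z => C * (1 + 2 * ‖z‖) ^ k, ?_, fun θ z => ?_⟩
  · exact (PG.const C).mul (((PG.const 1).add ((PG.const 2).mul PG.id.norm)).pow k)
  · refine (h _).trans ?_
    have h2 := rotp_norm_le θ z
    show C * (1 + ‖rotp θ z‖) ^ k ≤ C * (1 + 2 * ‖z‖) ^ k
    gcongr

theorem hasDerivAt_rotp_fst (θ : ℝ) (z : W × W) :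
    HasDerivAt (fun t => (rotp t z).1) (rotp θ z).2 θ := by
  unfold rotp
  exact ((Real.hasDerivAt_cos θ).smul_const z.1).add ((Real.hasDerivAt_sin θ).smul_const z.2)

theorem hasDerivAt_rotp_snd (θ : ℝ) (z : W × W) :
    HasDerivAt (fun t => (rotp t z).2) (-(rotp θ z).1) θ := by
  unfold rotp
  have := ((Real.hasDerivAt_sin θ).neg.smul_const z.1).add ((Real.hasDerivAt_cos θ).smul_const z.2)
  refine this.congr_deriv ?_
  simp only [neg_smul, neg_add]

/-- Gaussian integration by parts, in the rotation form. -/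
theorem ibp_rot (ν : Measure W) [IsGaussian ν] (h0 : ∫ x, x ∂ν = 0) {f D : W × W → E}
    (hf : PG f) (hD : PG D)
    (hd : ∀ θ z, HasDerivAt (fun t => f (rotp t z)) (D (rotp θ z)) θ) :
    ∫ z, D z ∂(ν.prod ν) = 0 := by
  obtain ⟨g, hg, hgD⟩ := hD.rotp_bound
  have hcf : ∀ t, Continuous fun z : W × W => f (rotp t z) := fun t =>
    hf.continuous.comp (rotp_continuous_right t)
  have hcD : ∀ t, Continuous fun z : W × W => D (rotp t z) := fun t =>
    hD.continuous.comp (rotp_continuous_right t)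
  obtain ⟨gf, hgf, hgf'⟩ := hf.rotp_bound
  have i1 : Integrable (fun z => f (rotp 0 z)) (ν.prod ν) :=
    (hgf.integrable (ν.prod ν)).mono' (hcf 0).aestronglyMeasurable
      (Eventually.of_forall (hgf' 0))
  have i2 : Integrable g (ν.prod ν) := hg.integrable _
  have key := hasDerivAt_integral_of_dominated_loc_of_deriv_le (μ := ν.prod ν)
    (F := fun t z => f (rotp t z)) (F' := fun t z => D (rotp t z)) (x₀ := (0:ℝ))
    (s := Set.univ) (bound := g) Filter.univ_mem
    (Eventually.of_forall fun t => (hcf t).aestronglyMeasurable) i1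
    (hcD 0).aestronglyMeasurable
    (Eventually.of_forall fun z t _ => hgD t z) i2
    (Eventually.of_forall fun z t _ => hd t z)
  have h1 := key.2
  simp only [integral_rotp ν h0 hf.continuous, integral_rotp ν h0 hD.continuous] at h1
  have h2 : HasDerivAt (fun _ : ℝ => ∫ z, f z ∂(ν.prod ν)) 0 0 := hasDerivAt_const _ _
  exact h1.unique h2

theorem sq_intervalIntegral_le {g : ℝ → ℝ} (hg : Continuous g) {a : ℝ} (ha : 0 ≤ a) :
    (∫ t in (0:ℝ)..a, g t) ^ 2 ≤ a * ∫ t in (0:ℝ)..a, g t ^ 2 := by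
  set I := ∫ t in (0:ℝ)..a, g t
  have h : 0 ≤ ∫ t in (0:ℝ)..a, (a * g t - I) ^ 2 :=
    intervalIntegral.integral_nonneg ha (fun t _ => sq_nonneg _)
  have e : ∫ t in (0:ℝ)..a, (a * g t - I) ^ 2
      = a ^ 2 * (∫ t in (0:ℝ)..a, g t ^ 2) - a * I ^ 2 := by
    have : ∀ t, (a * g t - I) ^ 2 = a ^ 2 * g t ^ 2 - 2 * a * I * g t + I ^ 2 := fun t => by ring
    simp only [this]
    rw [intervalIntegral.integral_add, intervalIntegral.integral_sub,
      intervalIntegral.integral_const_mul, intervalIntegral.integral_const_mul,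
      intervalIntegral.integral_const]
    · simp only [smul_eq_mul, sub_zero]; change _ - 2 * a * I * I + _ = _; ring
    all_goals apply Continuous.intervalIntegrable; fun_prop
  rw [e] at h
  rcases ha.eq_or_lt with rfl | hpos
  · simp [I]
  · have : 0 ≤ a * (a * (∫ t in (0:ℝ)..a, g t ^ 2) - I ^ 2) := by nlinarith
    have := nonneg_of_mul_nonneg_right this hpos
    linarith

/-- Gaussian Poincaré inequality (with a non-optimal constant). -/
theorem poincare (ν : Measure W) [IsGaussian ν] (h0 : ∫ x, x ∂ν = 0) {f : W → ℝ}
    {D : W × W → ℝ} (hf : PG f) (hD : PG D)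
    (hd : ∀ θ z, HasDerivAt (fun t => f (rotp t z).1) (D (rotp θ z)) θ) :
    ∫ x, (f x - ∫ y, f y ∂ν) ^ 2 ∂ν ≤ 2 * ∫ z, D z ^ 2 ∂(ν.prod ν) := by
  have hDr : ∀ z, Continuous fun t : ℝ => D (rotp t z) := fun z =>
    hD.continuous.comp (rotp_continuous_left z)
  have hpi : (0:ℝ) ≤ Real.pi / 2 := by positivity
  have h1 : ∀ z : W × W, (f z.2 - f z.1) ^ 2 ≤
      (Real.pi / 2) * ∫ t in (0:ℝ)..(Real.pi / 2), D (rotp t z) ^ 2 := by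
    intro z
    have := intervalIntegral.integral_eq_sub_of_hasDerivAt (a := 0) (b := Real.pi / 2)
      (fun t _ => hd t z) ((hDr z).intervalIntegrable _ _)
    have e : f z.2 - f z.1 = ∫ t in (0:ℝ)..(Real.pi / 2), D (rotp t z) := by
      rw [this]; simp [rotp]
    rw [e]
    exact sq_intervalIntegral_le (hDr z) hpi
  -- variance as a double integral
  set m := ∫ y, f y ∂ν with hm
  have hf1 : PG (fun z : W × W => f z.1) := hf.comp_clm (ContinuousLinearMap.fst ℝ W W)
  have hf2 : PG (fun z : W × W => f z.2) := hf.comp_clm (ContinuousLinearMap.snd ℝ W W)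
  have hV : ∫ z, (f z.2 - f z.1) ^ 2 ∂(ν.prod ν) = 2 * ∫ x, (f x - m) ^ 2 ∂ν := by
    have i2 : Integrable (fun x => (f x - m) ^ 2) ν :=
      ((hf.sub (PG.const m)).pow 2).integrable ν
    have i1 : Integrable (fun x => (f x - m)) ν := (hf.sub (PG.const m)).integrable ν
    have z1 : ∫ x, (f x - m) ∂ν = 0 := by
      rw [integral_sub (hf.integrable ν) (integrable_const _)]; simp [hm]
    have e : ∀ z : W × W, (f z.2 - f z.1) ^ 2 =
        (f z.1 - m) ^ 2 + (f z.2 - m) ^ 2 - 2 * ((f z.1 - m) * (f z.2 - m)) := fun z => by ring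
    simp only [e]
    rw [integral_sub, integral_add, integral_const_mul, integral_prod_mul (fun x => f x - m)
      (fun x => f x - m), z1]
    · rw [integral_fun_fst (μ := ν) (ν := ν) (f := fun x => (f x - m) ^ 2),
        integral_fun_snd (μ := ν) (ν := ν) (f := fun x => (f x - m) ^ 2)]
      simp; ring
    · exact i2.comp_fst ν
    · exact i2.comp_snd ν
    · exact (i2.comp_fst ν).add (i2.comp_snd ν)
    · exact (i1.mul_prod i1).const_mul 2
  obtain ⟨g, hg, hgD⟩ := (hD.pow 2).rotp_bound
  have hjoint : Continuous fun p : (W × W) × ℝ => D (rotp p.2 p.1) ^ 2 :=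
    (hD.continuous.comp rotp_continuous').pow 2
  have hIntg : Integrable (fun p : (W × W) × ℝ => D (rotp p.2 p.1) ^ 2)
      ((ν.prod ν).prod (volume.restrict (Set.Ioc 0 (Real.pi / 2)))) := by
    have hgi : Integrable (fun p : (W × W) × ℝ => g p.1)
      ((ν.prod ν).prod (volume.restrict (Set.Ioc 0 (Real.pi / 2)))) :=
      (hg.integrable (ν.prod ν)).comp_fst _
    exact hgi.mono' hjoint.aestronglyMeasurable (Eventually.of_forall fun p => hgD p.2 p.1)
  have hswap : ∫ z, (∫ t in (0:ℝ)..(Real.pi / 2), D (rotp t z) ^ 2) ∂(ν.prod ν)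
      = (Real.pi / 2) * ∫ z, D z ^ 2 ∂(ν.prod ν) := by
    simp only [intervalIntegral.integral_of_le hpi]
    rw [integral_integral_swap (f := fun z t => D (rotp t z) ^ 2) hIntg]
    have : ∀ t : ℝ, ∫ z, D (rotp t z) ^ 2 ∂(ν.prod ν) = ∫ z, D z ^ 2 ∂(ν.prod ν) := fun t =>
      integral_rotp ν h0 (f := fun z => D z ^ 2) (hD.continuous.pow 2) t
    simp only [this]
    rw [integral_const]
    simp [Measure.real, hpi, ENNReal.toReal_ofReal]
  have hle : ∫ z, (f z.2 - f z.1) ^ 2 ∂(ν.prod ν) ≤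
      ∫ z, ((Real.pi / 2) * ∫ t in (0:ℝ)..(Real.pi / 2), D (rotp t z) ^ 2) ∂(ν.prod ν) := by
    apply integral_mono
    · exact ((hf2.sub hf1).pow 2).integrable _
    · simp only [intervalIntegral.integral_of_le hpi]
      exact (hIntg.integral_prod_left).const_mul _
    · exact h1
  rw [hV, integral_const_mul, hswap] at hle
  have hD0 : 0 ≤ ∫ z, D z ^ 2 ∂(ν.prod ν) := integral_nonneg fun z => sq_nonneg _
  have hpi2 : Real.pi ^ 2 ≤ 16 := by nlinarith [Real.pi_pos, Real.pi_le_four]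
  nlinarith
end Rot

end PartA2

section PartM
open MeasureTheory ProbabilityTheory Filter Topology
open scoped Matrix.Norms.L2Operator

section Mat
variable {n : ℕ}

/-- Real square matrices. -/
abbrev MM (n : ℕ) := Matrix (Fin n) (Fin n) ℝ

/-- squared Frobenius norm -/
noncomputable def frob (A : MM n) : ℝ := ∑ i, ∑ j, A i j ^ 2

theorem frob_nonneg (A : MM n) : 0 ≤ frob A :=
  Finset.sum_nonneg fun _ _ => Finset.sum_nonneg fun _ _ => sq_nonneg _

theorem frob_transpose (A : MM n) : frob A.transpose = frob A := by
  unfold frob; rw [Finset.sum_comm]; rfl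

theorem frob_eq_trace (A : MM n) (hA : A.IsHermitian) : frob A = (A * A).trace := by
  unfold frob Matrix.trace
  refine Finset.sum_congr rfl fun i _ => ?_
  simp only [Matrix.diag_apply, Matrix.mul_apply]
  refine Finset.sum_congr rfl fun j _ => ?_
  have := hA.apply i j
  simp only [star_trivial] at this
  rw [this, sq]

theorem norm_one_le : ‖(1 : MM n)‖ ≤ 1 := by
  have h : ‖(1 : MM n)‖ * ‖(1 : MM n)‖ = ‖(1 : MM n)‖ := by
    have := CStarRing.norm_star_mul_self (x := (1 : MM n))
    simpa using this.symm
  by_contra hc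
  push Not at hc
  nlinarith

theorem norm_pow_le_all (A : MM n) (s : ℕ) : ‖A ^ s‖ ≤ ‖A‖ ^ s := by
  rcases Nat.eq_zero_or_pos s with rfl | h
  · simpa using norm_one_le
  · exact norm_pow_le' A h

theorem mulVec_sq_le (A : MM n) (v : Fin n → ℝ) :
    ∑ i, (A.mulVec v i) ^ 2 ≤ ‖A‖ ^ 2 * ∑ i, v i ^ 2 := by
  have h := Matrix.l2_opNorm_mulVec A (WithLp.toLp 2 v)
  have h2 := pow_le_pow_left₀ (norm_nonneg _) h 2
  rw [mul_pow, EuclideanSpace.norm_sq_eq, EuclideanSpace.norm_sq_eq] at h2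
  simpa [Matrix.toLpLin_apply] using h2

theorem norm_transpose (A : MM n) : ‖A.transpose‖ = ‖A‖ := by
  have := Matrix.l2_opNorm_conjTranspose A
  rwa [Matrix.conjTranspose_eq_transpose_of_trivial] at this

theorem frob_mul_le (A B : MM n) : frob (A * B) ≤ ‖A‖ ^ 2 * frob B := by
  unfold frob
  rw [Finset.sum_comm, Finset.sum_comm (f := fun i j => B i j ^ 2), Finset.mul_sum]
  refine Finset.sum_le_sum fun j _ => ?_
  have := mulVec_sq_le A (fun k => B k j)
  simpa [Matrix.mulVec, Matrix.mul_apply, dotProduct] using this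

theorem frob_mul_le' (A B : MM n) : frob (A * B) ≤ ‖B‖ ^ 2 * frob A := by
  have := frob_mul_le B.transpose A.transpose
  rwa [← Matrix.transpose_mul, frob_transpose, frob_transpose, norm_transpose] at this

theorem frob_sum_le (r : ℕ) (F : ℕ → MM n) :
    frob (∑ a ∈ Finset.range r, F a) ≤ r * ∑ a ∈ Finset.range r, frob (F a) := by
  have h : ∀ i j, (∑ a ∈ Finset.range r, F a) i j ^ 2 ≤ r * ∑ a ∈ Finset.range r, (F a i j) ^ 2 := by
    intro i j
    rw [Matrix.sum_apply]
    simpa using sq_sum_le_card_mul_sum_sq (s := Finset.range r) (f := fun a => F a i j)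
  calc frob (∑ a ∈ Finset.range r, F a)
      ≤ ∑ i, ∑ j, (r * ∑ a ∈ Finset.range r, (F a i j) ^ 2) :=
        Finset.sum_le_sum fun i _ => Finset.sum_le_sum fun j _ => h i j
    _ = r * ∑ a ∈ Finset.range r, frob (F a) := by
        unfold frob
        simp only [← Finset.mul_sum]
        congr 1
        rw [Finset.sum_comm]
        simp only [Finset.sum_comm (s := Finset.univ) (t := Finset.range r)]
        rw [Finset.sum_congr rfl]
        intro a _
        rw [Finset.sum_comm]

/-- bilinear bound criterion for the operator norm -/
theorem norm_le_of_bilin (A : MM n) (c : ℝ) (hc : 0 ≤ c)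
    (h : ∀ u v : Fin n → ℝ, dotProduct u (A.mulVec v) ≤ c * ((∑ i, u i ^ 2) + ∑ i, v i ^ 2) / 2) :
    ‖A‖ ≤ c := by
  rw [Matrix.l2_opNorm_def]
  refine ContinuousLinearMap.opNorm_le_bound _ hc fun x => ?_
  set v : Fin n → ℝ := WithLp.ofLp x
  set y : Fin n → ℝ := A.mulVec v
  have hx : ‖x‖ ^ 2 = ∑ i, v i ^ 2 := by rw [EuclideanSpace.norm_sq_eq]; simp [v]
  have hy : ‖(WithLp.toLp 2 y : EuclideanSpace ℝ (Fin n))‖ ^ 2 = ∑ i, y i ^ 2 := by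
    rw [EuclideanSpace.norm_sq_eq]; simp
  have e : (LinearEquiv.trans (Matrix.toEuclideanLin (𝕜 := ℝ) (m := Fin n) (n := Fin n)) LinearMap.toContinuousLinearMap) A x = WithLp.toLp 2 y := by
    rfl
  change ‖(LinearEquiv.trans (Matrix.toEuclideanLin (𝕜 := ℝ) (m := Fin n) (n := Fin n)) LinearMap.toContinuousLinearMap) A x‖ ≤ _
  rw [e]
  set Ny := ‖(WithLp.toLp 2 y : EuclideanSpace ℝ (Fin n))‖
  have hNy : 0 ≤ Ny := norm_nonneg _
  have hNx : 0 ≤ ‖x‖ := norm_nonneg _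
  by_contra hcon
  push Not at hcon
  have hNy0 : 0 < Ny := lt_of_le_of_lt (by positivity) hcon
  -- scale u = (‖x‖/Ny) y
  have key := h (fun i => (‖x‖ / Ny) * y i) v
  have e1 : dotProduct (fun i => (‖x‖ / Ny) * y i) (A.mulVec v) = ‖x‖ * Ny := by
    have : dotProduct (fun i => (‖x‖ / Ny) * y i) (A.mulVec v) = (‖x‖ / Ny) * ∑ i, y i ^ 2 := by
      simp only [dotProduct, Finset.mul_sum]
      refine Finset.sum_congr rfl fun i _ => ?_
      change _ * y i * y i = _; ring
    rw [this, ← hy]; field_simp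
  have e2 : ∑ i, ((‖x‖ / Ny) * y i) ^ 2 = ‖x‖ ^ 2 := by
    simp only [mul_pow, ← Finset.mul_sum]
    rw [← hy]; field_simp
  rw [e1, e2, ← hx] at key
  have hx0 : 0 < ‖x‖ := by
    rcases hNx.eq_or_lt with h0 | h0
    · exfalso
      have hz : x = 0 := norm_eq_zero.mp h0.symm
      have : y = 0 := by
        simp [y, v, hz]
      simp [Ny, this] at hNy0
    · exact h0
  nlinarith

theorem norm_sq_le_frob (A : MM n) : ‖A‖ ^ 2 ≤ frob A := by
  have : ‖A‖ ≤ Real.sqrt (frob A) := by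
    refine norm_le_of_bilin A _ (Real.sqrt_nonneg _) fun u v => ?_
    set a := ∑ i, u i ^ 2
    set b := ∑ i, v i ^ 2
    have ha : 0 ≤ a := Finset.sum_nonneg fun _ _ => sq_nonneg _
    have hb : 0 ≤ b := Finset.sum_nonneg fun _ _ => sq_nonneg _
    have h1 : dotProduct u (A.mulVec v) ^ 2 ≤ a * ∑ i, (A.mulVec v i) ^ 2 :=
      Finset.sum_mul_sq_le_sq_mul_sq _ _ _
    have h2 : ∑ i, (A.mulVec v i) ^ 2 ≤ frob A * b := by
      unfold frob
      rw [Finset.sum_mul]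
      refine Finset.sum_le_sum fun i _ => ?_
      exact Finset.sum_mul_sq_le_sq_mul_sq Finset.univ (fun j => A i j) v
    have h3 : dotProduct u (A.mulVec v) ^ 2 ≤ (Real.sqrt (frob A) * (a + b) / 2) ^ 2 := by
      have : (Real.sqrt (frob A) * (a + b) / 2) ^ 2 = frob A * ((a + b) / 2) ^ 2 := by
        rw [mul_div_assoc, mul_pow, Real.sq_sqrt (frob_nonneg A)]
      rw [this]
      have h4 : a * b ≤ ((a + b) / 2) ^ 2 := by nlinarith [sq_nonneg (a - b)]
      calc _ ≤ a * (frob A * b) := h1.trans (mul_le_mul_of_nonneg_left h2 ha)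
        _ = frob A * (a * b) := by ring
        _ ≤ _ := mul_le_mul_of_nonneg_left h4 (frob_nonneg A)
    exact (abs_le_of_sq_le_sq' h3 (by positivity)).2
  calc ‖A‖ ^ 2 ≤ Real.sqrt (frob A) ^ 2 := pow_le_pow_left₀ (norm_nonneg _) this 2
    _ = _ := Real.sq_sqrt (frob_nonneg A)

theorem entry_le (A : MM n) (i j : Fin n) : |A i j| ≤ ‖A‖ := by
  have h := mulVec_sq_le A (Pi.single j 1)
  have e : ∑ k, (Pi.single j (1:ℝ) : Fin n → ℝ) k ^ 2 = 1 := by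
    simp [Pi.single_apply, ite_pow]
  rw [e, mul_one] at h
  have h2 : (A i j) ^ 2 ≤ ‖A‖ ^ 2 := by
    refine le_trans ?_ h
    have := Finset.single_le_sum (f := fun k => (A.mulVec (Pi.single j 1) k) ^ 2)
      (fun k _ => sq_nonneg _) (Finset.mem_univ i)
    simpa using this
  exact abs_le_of_sq_le_sq h2 (norm_nonneg _)

theorem spec_pow {A : MM n} (hA : A.IsHermitian) (s : ℕ) :
    A ^ s = (hA.eigenvectorUnitary : MM n) * Matrix.diagonal (fun i => hA.eigenvalues i ^ s) *
      star (hA.eigenvectorUnitary : MM n) := by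
  have h := hA.spectral_theorem
  conv_lhs => rw [h, ← map_pow, Unitary.conjStarAlgAut_apply, Matrix.diagonal_pow]
  congr 3

theorem trace_mul_pow {A : MM n} (hA : A.IsHermitian) (M : MM n) (s : ℕ) :
    (M * A ^ s).trace = ∑ i, (star (hA.eigenvectorUnitary : MM n) * M *
      (hA.eigenvectorUnitary : MM n)) i i * hA.eigenvalues i ^ s := by
  rw [spec_pow hA s, ← Matrix.mul_assoc, Matrix.trace_mul_comm, ← Matrix.mul_assoc,
    ← Matrix.mul_assoc]
  simp [Matrix.trace, Matrix.mul_diagonal]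

theorem trace_pow_eq {A : MM n} (hA : A.IsHermitian) (s : ℕ) :
    (A ^ s).trace = ∑ i, hA.eigenvalues i ^ s := by
  have := trace_mul_pow hA 1 s
  simpa using this

theorem abs_trace_mul_pow_le {A : MM n} (hA : A.IsHermitian) (M : MM n) (s : ℕ) :
    |(M * A ^ s).trace| ≤ ‖M‖ * ∑ i, |hA.eigenvalues i| ^ s := by
  rw [trace_mul_pow hA, Finset.mul_sum]
  refine (Finset.abs_sum_le_sum_abs _ _).trans (Finset.sum_le_sum fun i _ => ?_)
  rw [abs_mul, abs_pow]
  gcongr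
  refine (entry_le _ i i).trans ?_
  rw [CStarRing.norm_mul_coe_unitary, ← Unitary.coe_star, CStarRing.norm_coe_unitary_mul]

theorem abs_eig_le {A : MM n} (hA : A.IsHermitian) (i : Fin n) : |hA.eigenvalues i| ≤ ‖A‖ := by
  have h := spec_pow hA 1
  simp only [pow_one] at h
  have h2 : ‖A‖ = ‖Matrix.diagonal hA.eigenvalues‖ := by
    conv_lhs => rw [h]
    rw [← Unitary.coe_star, CStarRing.norm_mul_coe_unitary, CStarRing.norm_coe_unitary_mul]
  rw [h2]
  simpa using entry_le (Matrix.diagonal hA.eigenvalues) i i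

theorem norm_pow_le_trace {A : MM n} (hA : A.IsHermitian) (hn : 0 < n) {p : ℕ} (hp : Even p) :
    ‖A‖ ^ p ≤ (A ^ p).trace := by
  have h := spec_pow hA 1
  simp only [pow_one] at h
  have h2 : ‖A‖ = ‖Matrix.diagonal hA.eigenvalues‖ := by
    conv_lhs => rw [h]
    rw [← Unitary.coe_star, CStarRing.norm_mul_coe_unitary, CStarRing.norm_coe_unitary_mul]
  rw [h2, Matrix.l2_opNorm_diagonal, trace_pow_eq hA]
  have : Nonempty (Fin n) := ⟨⟨0, hn⟩⟩
  obtain ⟨i, hi⟩ := Finite.exists_max (fun i => |hA.eigenvalues i|)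
  have h3 : ‖hA.eigenvalues‖ ≤ |hA.eigenvalues i| :=
    (pi_norm_le_iff_of_nonneg (abs_nonneg _)).2 fun j => by simpa using hi j
  calc ‖hA.eigenvalues‖ ^ p ≤ |hA.eigenvalues i| ^ p := pow_le_pow_left₀ (norm_nonneg _) h3 p
    _ = hA.eigenvalues i ^ p := hp.pow_abs _
    _ ≤ _ := Finset.single_le_sum (f := fun i => hA.eigenvalues i ^ p)
        (fun j _ => hp.pow_nonneg _) (Finset.mem_univ i)

theorem abs_trace_pow_le {A : MM n} (hA : A.IsHermitian) (p : ℕ) :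
    |(A ^ p).trace| ≤ n * ‖A‖ ^ p := by
  rw [trace_pow_eq hA]
  refine (Finset.abs_sum_le_sum_abs _ _).trans ?_
  calc ∑ i, |hA.eigenvalues i ^ p| ≤ ∑ i : Fin n, ‖A‖ ^ p := Finset.sum_le_sum fun i _ => by
        rw [abs_pow]; exact pow_le_pow_left₀ (abs_nonneg _) (abs_eig_le hA i) p
    _ = _ := by simp

theorem trace_four {A H : MM n} (hA : A.IsHermitian) (hH : H.IsHermitian) :
    ∃ w : Fin n → Fin n → ℝ, (∀ i j, 0 ≤ w i j) ∧ (∀ i j, w i j = w j i) ∧ ∀ r s : ℕ,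
      (H * A ^ r * H * A ^ s).trace =
        ∑ i, ∑ j, w i j * (hA.eigenvalues i ^ r * hA.eigenvalues j ^ s) := by
  set U := (hA.eigenvectorUnitary : MM n)
  set N := star U * H * U with hN
  have hNh : ∀ i j, N i j = N j i := by
    intro i j
    have : star N = N := by
      simp only [hN, star_mul, star_star]
      rw [Matrix.star_eq_conjTranspose H, hH.eq]; simp [mul_assoc]
    have h2 := congrFun (congrFun this i) j
    simpa [Matrix.star_eq_conjTranspose] using h2.symm
  refine ⟨fun i j => N i j ^ 2, fun i j => sq_nonneg _, fun i j => congrArg (· ^ 2) (hNh i j), fun r s => ?_⟩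
  rw [trace_mul_pow hA]
  change ∑ j, (star U * (H * A ^ r * H) * U) j j * hA.eigenvalues j ^ s = _
  have e : star U * (H * A ^ r * H) * U =
      N * Matrix.diagonal (fun i => hA.eigenvalues i ^ r) * N := by
    rw [spec_pow hA r]; simp only [hN, mul_assoc]; rfl
  rw [e, Finset.sum_comm]
  refine Finset.sum_congr rfl fun j _ => ?_
  rw [Matrix.mul_apply, Finset.sum_mul]
  refine Finset.sum_congr rfl fun i _ => ?_
  rw [Matrix.mul_diagonal, hNh j i]; ring

end Mat

end PartM

section PartG
open MeasureTheory ProbabilityTheory Filter Topology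
open scoped Matrix.Norms.L2Operator

section GMsec
variable {n : ℕ}

noncomputable instance instMeasMM : MeasurableSpace (MM n) := borel _
instance instBorelMM : BorelSpace (MM n) := ⟨rfl⟩

/-- trace as a continuous linear map -/
noncomputable def trL : MM n →L[ℝ] ℝ := (Matrix.traceLinearMap (Fin n) ℝ ℝ).toContinuousLinearMap

theorem trL_apply (A : MM n) : trL A = A.trace := rfl

/-- matrix entry as a linear map -/
def entl (i j : Fin n) : MM n →ₗ[ℝ] ℝ where
  toFun A := A i j
  map_add' _ _ := rfl
  map_smul' _ _ := rfl

/-- matrix entry as a continuous linear map -/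
noncomputable def entL (i j : Fin n) : MM n →L[ℝ] ℝ := (entl i j).toContinuousLinearMap

theorem entL_apply (i j : Fin n) (A : MM n) : entL i j A = A i j := rfl

theorem PG.trace {W : Type*} [NormedAddCommGroup W] {f : W → MM n} (hf : PG f) :
    PG (fun x => (f x).trace) := PG.clm hf trL

theorem PG.entry {W : Type*} [NormedAddCommGroup W] {f : W → MM n} (hf : PG f) (i j : Fin n) :
    PG (fun x => f x i j) := PG.clm hf (entL i j)

/-- the covariance map -/
noncomputable def KK (ν : Measure (MM n)) (A : MM n) : MM n := ∫ H, H * A * H ∂ν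

structure GM (ν : Measure (MM n)) (ε : ℝ) : Prop where
  gauss : IsGaussian ν
  mean : ∫ A, A ∂ν = 0
  herm : ∀ᵐ A ∂ν, A.IsHermitian
  eps : 0 ≤ ε
  h1 : ‖KK ν 1 - 1‖ ≤ ε
  h2 : ∀ W : MM n, ∫ B, (B * W).trace ^ 2 ∂ν ≤ ε * frob W
  h3 : ∑ i, ∑ j, ∑ k, ∑ l, (∫ B, B i j * B k l ∂ν) ^ 2 ≤ 3

theorem pgHAH (A : MM n) : PG (fun H : MM n => H * A * H) :=
  (PG.id.mul (PG.const A)).mul PG.id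

theorem KK_add (ν : Measure (MM n)) [IsGaussian ν] (A B : MM n) :
    KK ν (A + B) = KK ν A + KK ν B := by
  unfold KK
  rw [← integral_add ((pgHAH A).integrable ν) ((pgHAH B).integrable ν)]
  simp only [mul_add, add_mul]

theorem KK_smul (ν : Measure (MM n)) (c : ℝ) (A : MM n) :
    KK ν (c • A) = c • KK ν A := by
  unfold KK
  rw [← integral_smul]
  simp only [mul_smul_comm, smul_mul_assoc]

/-- the covariance map as a continuous linear map -/
noncomputable def KL (ν : Measure (MM n)) [IsGaussian ν] : MM n →L[ℝ] MM n :=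
  LinearMap.toContinuousLinearMap
    ({ toFun := KK ν, map_add' := KK_add ν, map_smul' := KK_smul ν } : MM n →ₗ[ℝ] MM n)

theorem KL_apply (ν : Measure (MM n)) [IsGaussian ν] (A : MM n) : KL ν A = KK ν A := rfl

theorem KK_sub (ν : Measure (MM n)) [IsGaussian ν] (A B : MM n) :
    KK ν (A - B) = KK ν A - KK ν B := (KL ν).map_sub A B

theorem PG.KK {W : Type*} [NormedAddCommGroup W] (ν : Measure (MM n)) [IsGaussian ν]
    {f : W → MM n} (hf : PG f) : PG (fun x => KK ν (f x)) := PG.clm hf (KL ν)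

/-- the covariance slices -/
noncomputable def NN (ν : Measure (MM n)) (i l : Fin n) : MM n :=
  Matrix.of fun k j => ∫ B, B i j * B k l ∂ν

theorem KK_entry (ν : Measure (MM n)) [IsGaussian ν] (A : MM n) (i l : Fin n) :
    KK ν A i l = (NN ν i l * A).trace := by
  have h1 : KK ν A i l = ∫ H, (H * A * H) i l ∂ν := by
    exact ((entL i l).integral_comp_comm ((pgHAH A).integrable ν)).symm
  rw [h1]
  simp only [Matrix.mul_apply, Matrix.trace, Matrix.diag_apply, NN, Matrix.of_apply, Finset.sum_mul]
  have hi : ∀ k j : Fin n, Integrable (fun H : MM n => H i j * A j k * H k l) ν := fun k j =>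
    (((PG.id.entry i j).mul (PG.const (A j k))).mul (PG.id.entry k l)).integrable ν
  rw [integral_finsetSum _ fun k _ => integrable_finsetSum _ fun j _ => hi k j]
  refine Finset.sum_congr rfl fun k _ => ?_
  rw [integral_finsetSum _ fun j _ => hi k j]
  refine Finset.sum_congr rfl fun j _ => ?_
  rw [← integral_mul_const]
  refine integral_congr_ae (Eventually.of_forall fun H => ?_)
  simp only; ring

theorem KK_integral (ν : Measure (MM n)) [IsGaussian ν] (r : ℕ) :
    ∫ A, KK ν (A ^ r) ∂ν = KK ν (∫ A, A ^ r ∂ν) :=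
  (KL ν).integral_comp_comm ((PG.id.pow r).integrable ν)

/-- integration by parts for powers -/
theorem ibp_pow {ν : Measure (MM n)} {ε : ℝ} (h : GM ν ε) (p : ℕ) :
    ∫ A, A ^ (p + 2) ∂ν = ∑ i ∈ Finset.range (p + 1), ∫ A, KK ν (A ^ (p - i)) * A ^ i ∂ν := by
  have := h.gauss
  have pgi : ∀ i, PG (fun z : MM n × MM n => z.2 * z.1 ^ (p - i) * z.2 * z.1 ^ i) := fun i =>
    ((PG.snd.mul (PG.fst.pow _)).mul PG.snd).mul (PG.fst.pow _)
  have key := ibp_rot ν h.mean (f := fun z : MM n × MM n => z.2 * z.1 ^ (p + 1))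
    (D := fun z => - z.1 ^ (p + 2) +
      ∑ i ∈ Finset.range (p + 1), z.2 * z.1 ^ (p - i) * z.2 * z.1 ^ i)
    (PG.snd.mul (PG.fst.pow _)) ((PG.fst.pow _).neg.add (PG.sum _ fun i _ => pgi i))
    (fun θ z => by
      have h1 := (hasDerivAt_rotp_snd θ z).mul ((hasDerivAt_rotp_fst θ z).pow' (p + 1))
      refine h1.congr_deriv ?_
      simp only [Finset.mul_sum, Nat.pred_succ, Pi.pow_apply, pow_succ', neg_mul, mul_assoc])
  rw [integral_add ((PG.fst.pow _).neg.integrable _) ((PG.sum _ fun i _ => pgi i).integrable _),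
    integral_neg, integral_finsetSum _ (fun i _ => (pgi i).integrable _)] at key
  have e1 : ∫ z : MM n × MM n, z.1 ^ (p + 2) ∂(ν.prod ν) = ∫ A, A ^ (p + 2) ∂ν := by
    rw [integral_fun_fst (μ := ν) (ν := ν) (f := fun A : MM n => A ^ (p + 2))]; simp
  rw [e1] at key
  rw [← sub_eq_zero, ← neg_eq_zero, neg_sub, sub_eq_neg_add, ← key]
  congr 1
  refine Finset.sum_congr rfl fun i _ => ?_
  rw [integral_prod _ ((pgi i).integrable _)]
  refine integral_congr_ae (Eventually.of_forall fun A => ?_)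
  simp only
  have := (ContinuousLinearMap.mul ℝ (MM n)).flip (A ^ i) |>.integral_comp_comm
    ((pgHAH (A ^ (p - i))).integrable ν)
  simpa [KK] using this.symm

/-- derivative weight -/
noncomputable def Wt (M : MM n) (r : ℕ) (A : MM n) : MM n :=
  ∑ i ∈ Finset.range r, A ^ i * M * A ^ (r - 1 - i)

theorem pgWt (M : MM n) (r : ℕ) : PG (Wt M r) :=
  PG.sum _ fun i _ => ((PG.id.pow i).mul (PG.const M)).mul (PG.id.pow _)

theorem PG.frob {W : Type*} [NormedAddCommGroup W] {f : W → MM n} (hf : PG f) :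
    PG (fun x => frob (f x)) :=
  PG.sum _ fun i _ => PG.sum _ fun j _ => (hf.entry i j).pow 2

theorem var_trace {ν : Measure (MM n)} {ε : ℝ} (h : GM ν ε) (M : MM n) (r : ℕ) :
    ∫ A, ((M * A ^ r).trace - ∫ A, (M * A ^ r).trace ∂ν) ^ 2 ∂ν
      ≤ 2 * (ε * ∫ A, frob (Wt M r A) ∂ν) := by
  have := h.gauss
  have pgD : PG (fun z : MM n × MM n => (z.2 * Wt M r z.1).trace) :=
    (PG.snd.mul ((pgWt M r).comp_clm (ContinuousLinearMap.fst ℝ (MM n) (MM n)))).trace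
  have key := poincare ν h.mean (f := fun A : MM n => (M * A ^ r).trace)
    (D := fun z => (z.2 * Wt M r z.1).trace) (((PG.const M).mul (PG.id.pow r)).trace) pgD
    (fun θ z => by
      have h1 := ((hasDerivAt_rotp_fst θ z).pow' r)
      have h2 := trL.hasFDerivAt.comp_hasDerivAt θ (h1.const_mul M)
      refine h2.congr_deriv ?_
      simp only [trL_apply, Wt, Finset.mul_sum, Matrix.trace_sum]
      refine Finset.sum_congr rfl fun i _ => ?_
      rw [Nat.pred_eq_sub_one, mul_assoc _ _ ((rotp θ z).1 ^ i), ← mul_assoc M,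
        Matrix.trace_mul_comm, mul_assoc, mul_assoc])
  refine key.trans (mul_le_mul_of_nonneg_left ?_ zero_le_two)
  rw [integral_prod _ ((pgD.pow 2).integrable _), ← integral_const_mul]
  refine integral_mono ((pgD.pow 2).integrable (ν.prod ν)).integral_prod_left
    (((pgWt M r).frob.integrable ν).const_mul ε) fun A => ?_
  exact h.h2 (Wt M r A)

theorem frob_Wt_le (M : MM n) (r : ℕ) (A : MM n) :
    frob (Wt M r A) ≤ r ^ 2 * frob M * ‖A‖ ^ (2 * (r - 1)) := by
  refine (frob_sum_le r _).trans ?_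
  have : ∀ i ∈ Finset.range r, frob (A ^ i * M * A ^ (r - 1 - i)) ≤
      frob M * ‖A‖ ^ (2 * (r - 1)) := by
    intro i hi
    have hi' := Finset.mem_range.1 hi
    refine (frob_mul_le' _ _).trans ?_
    have h1 := frob_mul_le (A ^ i) M
    have h2 := norm_pow_le_all A i
    have h3 := norm_pow_le_all A (r - 1 - i)
    have h4 := frob_nonneg M
    calc ‖A ^ (r - 1 - i)‖ ^ 2 * frob (A ^ i * M)
        ≤ (‖A‖ ^ (r - 1 - i)) ^ 2 * ((‖A‖ ^ i) ^ 2 * frob M) := by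
          have : frob (A ^ i * M) ≤ (‖A‖ ^ i) ^ 2 * frob M := h1.trans (by gcongr)
          gcongr
          exact frob_nonneg _
      _ = frob M * ‖A‖ ^ (2 * (r - 1)) := by
          have : 2 * (r - 1) = (r - 1 - i) * 2 + i * 2 := by omega
          rw [this, pow_add, pow_mul, pow_mul]; ring
  calc (r:ℝ) * ∑ i ∈ Finset.range r, frob (A ^ i * M * A ^ (r - 1 - i))
      ≤ r * ∑ i ∈ Finset.range r, frob M * ‖A‖ ^ (2 * (r - 1)) := by
        gcongr with i hi; exact this i hi
    _ = _ := by simp; ring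

theorem var_trace_gen {ν : Measure (MM n)} {ε : ℝ} (h : GM ν ε) (M : MM n) (r : ℕ) :
    ∫ A, ((M * A ^ r).trace - ∫ A, (M * A ^ r).trace ∂ν) ^ 2 ∂ν
      ≤ 2 * ε * r ^ 2 * frob M * ∫ A, ‖A‖ ^ (2 * (r - 1)) ∂ν := by
  have := h.gauss
  refine (var_trace h M r).trans ?_
  have h1 : ∫ A, frob (Wt M r A) ∂ν ≤ ∫ A, r ^ 2 * frob M * ‖A‖ ^ (2 * (r - 1)) ∂ν :=
    integral_mono ((pgWt M r).frob.integrable ν)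
      (((PG.id.norm.pow _).integrable ν).const_mul _) fun A => frob_Wt_le M r A
  rw [integral_const_mul] at h1
  have := mul_le_mul_of_nonneg_left h1 h.eps
  nlinarith

theorem var_trace_one {ν : Measure (MM n)} {ε : ℝ} (h : GM ν ε) (r : ℕ) :
    ∫ A, ((A ^ r).trace - ∫ A, (A ^ r).trace ∂ν) ^ 2 ∂ν
      ≤ 2 * ε * r ^ 2 * ∫ A, (A ^ (2 * (r - 1))).trace ∂ν := by
  have := h.gauss
  have h0 := var_trace h 1 r
  simp only [one_mul] at h0
  refine h0.trans ?_
  have h1 : ∫ A, frob (Wt 1 r A) ∂ν = ∫ A, r ^ 2 * (A ^ (2 * (r - 1))).trace ∂ν := by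
    refine integral_congr_ae ?_
    filter_upwards [h.herm] with A hA
    have e : Wt 1 r A = (r : ℝ) • A ^ (r - 1) := by
      unfold Wt
      have : ∀ i ∈ Finset.range r, A ^ i * 1 * A ^ (r - 1 - i) = A ^ (r - 1) := by
        intro i hi
        have hi' := Finset.mem_range.1 hi
        rw [mul_one, ← pow_add]; congr 1; omega
      rw [Finset.sum_congr rfl this]; simp [Nat.cast_smul_eq_nsmul]
    have e2 : frob ((r:ℝ) • A ^ (r - 1)) = r ^ 2 * frob (A ^ (r - 1)) := by
      simp [frob, mul_pow, Finset.mul_sum]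
    rw [e, e2, frob_eq_trace _ (hA.pow _), ← pow_add]
    congr 4; omega
  rw [h1, integral_const_mul]
  apply le_of_eq; ring

theorem kk_fluct {ν : Measure (MM n)} {ε : ℝ} (h : GM ν ε) (r : ℕ) :
    ∫ A, ‖KK ν (A ^ r - ∫ B, B ^ r ∂ν)‖ ^ 2 ∂ν
      ≤ 6 * ε * r ^ 2 * ∫ A, ‖A‖ ^ (2 * (r - 1)) ∂ν := by
  have := h.gauss
  set m := ∫ B, B ^ r ∂ν with hm
  have pg1 : PG (fun A : MM n => KK ν (A ^ r - m)) := PG.KK ν ((PG.id.pow r).sub (PG.const m))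
  have ent : ∀ i l (A : MM n), KK ν (A ^ r - m) i l =
      (NN ν i l * A ^ r).trace - ∫ A, (NN ν i l * A ^ r).trace ∂ν := by
    intro i l A
    rw [KK_entry, mul_sub, Matrix.trace_sub]
    congr 1
    have h1 := (trL.comp (ContinuousLinearMap.mul ℝ (MM n) (NN ν i l))).integral_comp_comm
      ((PG.id.pow r).integrable ν)
    simpa [trL_apply] using h1.symm
  have hI : 0 ≤ ∫ A, ‖A‖ ^ (2 * (r - 1)) ∂ν := integral_nonneg fun A => by positivity
  calc ∫ A, ‖KK ν (A ^ r - m)‖ ^ 2 ∂ν ≤ ∫ A, frob (KK ν (A ^ r - m)) ∂ν :=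
        integral_mono ((pg1.norm.pow 2).integrable ν) (pg1.frob.integrable ν)
          fun A => norm_sq_le_frob _
    _ = ∑ i, ∑ l, ∫ A, (KK ν (A ^ r - m) i l) ^ 2 ∂ν := by
        unfold frob
        rw [integral_finsetSum _ fun i _ => integrable_finsetSum _ fun l _ =>
          ((pg1.entry i l).pow 2).integrable ν]
        refine Finset.sum_congr rfl fun i _ => ?_
        rw [integral_finsetSum _ fun l _ => ((pg1.entry i l).pow 2).integrable ν]
    _ ≤ ∑ i, ∑ l, 2 * ε * r ^ 2 * frob (NN ν i l) * ∫ A, ‖A‖ ^ (2 * (r - 1)) ∂ν := by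
        refine Finset.sum_le_sum fun i _ => Finset.sum_le_sum fun l _ => ?_
        simp only [ent]
        exact var_trace_gen h (NN ν i l) r
    _ = 2 * ε * r ^ 2 * (∫ A, ‖A‖ ^ (2 * (r - 1)) ∂ν) * ∑ i, ∑ l, frob (NN ν i l) := by
        simp only [Finset.mul_sum]
        refine Finset.sum_congr rfl fun i _ => Finset.sum_congr rfl fun l _ => by ring
    _ ≤ 2 * ε * r ^ 2 * (∫ A, ‖A‖ ^ (2 * (r - 1)) ∂ν) * 3 := by
        have hε := h.eps
        refine mul_le_mul_of_nonneg_left ?_ (by positivity)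
        refine le_trans (le_of_eq ?_) h.h3
        refine Finset.sum_congr rfl fun i _ => ?_
        simp only [frob, NN, Matrix.of_apply]
        rw [Finset.sum_comm]
        conv_lhs => rw [Finset.sum_congr rfl fun k _ => Finset.sum_comm]
        rw [Finset.sum_comm]
    _ = _ := by ring

theorem KK_norm {ν : Measure (MM n)} {ε : ℝ} (h : GM ν ε) (A : MM n) :
    ‖KK ν A‖ ≤ (1 + ε) * ‖A‖ := by
  have := h.gauss
  have hε := h.eps
  have bil : ∀ (X : MM n) (u v : Fin n → ℝ),
      dotProduct u ((KK ν X).mulVec v) = ∫ H, dotProduct u ((H * X * H).mulVec v) ∂ν := by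
    intro X u v
    let l : MM n →ₗ[ℝ] ℝ :=
      { toFun := fun Z => dotProduct u (Z.mulVec v)
        map_add' := fun a b => by rw [Matrix.add_mulVec, dotProduct_add]
        map_smul' := fun c a => by rw [Matrix.smul_mulVec, dotProduct_smul]; rfl }
    exact (l.toContinuousLinearMap.integral_comp_comm ((pgHAH X).integrable ν)).symm
  have pgb : ∀ (X : MM n) (u v : Fin n → ℝ),
      PG fun H : MM n => dotProduct u ((H * X * H).mulVec v) := by
    intro X u v
    let l : MM n →ₗ[ℝ] ℝ :=
      { toFun := fun Z => dotProduct u (Z.mulVec v)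
        map_add' := fun a b => by rw [Matrix.add_mulVec, dotProduct_add]
        map_smul' := fun c a => by rw [Matrix.smul_mulVec, dotProduct_smul]; rfl }
    exact PG.clm (pgHAH X) l.toContinuousLinearMap
  have one_bd : ∀ u : Fin n → ℝ, dotProduct u ((KK ν 1).mulVec u) ≤ (1 + ε) * ∑ i, u i ^ 2 := by
    intro u
    have hk : ‖KK ν 1‖ ≤ 1 + ε := by
      calc ‖KK ν 1‖ = ‖1 + (KK ν 1 - 1)‖ := by congr 1; abel
        _ ≤ ‖(1 : MM n)‖ + ‖KK ν 1 - 1‖ := norm_add_le _ _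
        _ ≤ 1 + ε := add_le_add norm_one_le h.h1
    set a := ∑ i, u i ^ 2
    have ha : 0 ≤ a := Finset.sum_nonneg fun _ _ => sq_nonneg _
    have h1 : dotProduct u ((KK ν 1).mulVec u) ^ 2 ≤ a * ∑ i, ((KK ν 1).mulVec u i) ^ 2 :=
      Finset.sum_mul_sq_le_sq_mul_sq _ _ _
    have h2 := mulVec_sq_le (KK ν 1) u
    have h3 : dotProduct u ((KK ν 1).mulVec u) ^ 2 ≤ ((1 + ε) * a) ^ 2 := by
      calc _ ≤ a * (‖KK ν 1‖ ^ 2 * a) := h1.trans (mul_le_mul_of_nonneg_left h2 ha)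
        _ ≤ a * ((1 + ε) ^ 2 * a) := by gcongr
        _ = _ := by ring
    exact (abs_le_of_sq_le_sq' h3 (by positivity)).2
  refine norm_le_of_bilin _ _ (by positivity) fun u v => ?_
  rw [bil]
  have pt : ∀ᵐ H ∂ν, dotProduct u ((H * A * H).mulVec v) ≤
      ‖A‖ * (dotProduct u ((H * 1 * H).mulVec u) + dotProduct v ((H * 1 * H).mulVec v)) / 2 := by
    filter_upwards [h.herm] with H hH
    have hs : H.transpose = H := by
      have := hH.eq; rwa [Matrix.conjTranspose_eq_transpose_of_trivial] at this
    have key : ∀ (X : MM n) (a b : Fin n → ℝ),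
        dotProduct a ((H * X * H).mulVec b) = dotProduct (H.mulVec a) (X.mulVec (H.mulVec b)) := by
      intro X a b
      rw [mul_assoc, ← Matrix.mulVec_mulVec, ← Matrix.mulVec_mulVec, Matrix.dotProduct_mulVec,
        ← Matrix.mulVec_transpose, hs]
    rw [key, key, key, Matrix.one_mulVec, Matrix.one_mulVec]
    set x := H.mulVec u
    set y := H.mulVec v
    have ex : dotProduct x x = ∑ i, x i ^ 2 := by simp [dotProduct, sq]
    have ey : dotProduct y y = ∑ i, y i ^ 2 := by simp [dotProduct, sq]
    rw [ex, ey]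
    set a := ∑ i, x i ^ 2
    set b := ∑ i, y i ^ 2
    have ha : 0 ≤ a := Finset.sum_nonneg fun _ _ => sq_nonneg _
    have hb : 0 ≤ b := Finset.sum_nonneg fun _ _ => sq_nonneg _
    have h1 : dotProduct x (A.mulVec y) ^ 2 ≤ a * ∑ i, (A.mulVec y i) ^ 2 :=
      Finset.sum_mul_sq_le_sq_mul_sq _ _ _
    have h2 := mulVec_sq_le A y
    have h3 : dotProduct x (A.mulVec y) ^ 2 ≤ (‖A‖ * (a + b) / 2) ^ 2 := by
      calc _ ≤ a * (‖A‖ ^ 2 * b) := h1.trans (mul_le_mul_of_nonneg_left h2 ha)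
        _ = ‖A‖ ^ 2 * (a * b) := by ring
        _ ≤ ‖A‖ ^ 2 * ((a + b) / 2) ^ 2 := by
          refine mul_le_mul_of_nonneg_left ?_ (sq_nonneg _)
          nlinarith [sq_nonneg (a - b)]
        _ = _ := by ring
    exact (abs_le_of_sq_le_sq' h3 (by positivity)).2
  have hIntg : Integrable (fun H : MM n => ‖A‖ * (dotProduct u ((H * 1 * H).mulVec u) +
      dotProduct v ((H * 1 * H).mulVec v)) / 2) ν :=
    ((((pgb 1 u u).add (pgb 1 v v)).integrable ν).const_mul ‖A‖).div_const 2
  refine (integral_mono_ae ((pgb A u v).integrable ν) hIntg pt).trans ?_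
  rw [integral_div, integral_const_mul, integral_add ((pgb 1 u u).integrable ν)
    ((pgb 1 v v).integrable ν), ← bil, ← bil]
  have h1 := one_bd u
  have h2 := one_bd v
  have := mul_le_mul_of_nonneg_left (add_le_add h1 h2) (norm_nonneg A)
  nlinarith

end GMsec

end PartG

section PartS1
open MeasureTheory ProbabilityTheory Filter Topology
open scoped Matrix.Norms.L2Operator

/-- semicircle moments -/
noncomputable def cc : ℕ → ℝ
  | 0 => 1
  | 1 => 0
  | (p + 2) => ∑ i : Fin (p + 1), cc (p - i) * cc i
decreasing_by all_goals omega

theorem cc_zero : cc 0 = 1 := by rw [cc]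
theorem cc_one : cc 1 = 0 := by rw [cc]
theorem cc_rec (p : ℕ) : cc (p + 2) = ∑ i ∈ Finset.range (p + 1), cc (p - i) * cc i := by
  rw [cc, Finset.sum_range]

theorem cc_nonneg (p : ℕ) : 0 ≤ cc p := by
  induction p using Nat.strong_induction_on with
  | _ p ih =>
    match p with
    | 0 => rw [cc_zero]; exact zero_le_one
    | 1 => rw [cc_one]
    | p + 2 =>
      rw [cc_rec]
      refine Finset.sum_nonneg fun i hi => ?_
      have := Finset.mem_range.1 hi
      exact mul_nonneg (ih _ (by omega)) (ih _ (by omega))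

theorem conv_le_sq (f : ℕ → ℝ) (hf : ∀ i, 0 ≤ f i) (N : ℕ) :
    ∑ p ∈ Finset.range N, ∑ i ∈ Finset.range (p + 1), f (p - i) * f i
      ≤ (∑ i ∈ Finset.range N, f i) ^ 2 := by
  rw [Finset.sum_range_diag_flip N (fun k m => f m * f k), sq, Finset.sum_mul]
  refine Finset.sum_le_sum fun i _ => ?_
  rw [← Finset.sum_mul, mul_comm]
  refine mul_le_mul_of_nonneg_left ?_ (hf i)
  exact Finset.sum_le_sum_of_subset_of_nonneg
    (Finset.range_mono (Nat.sub_le N i)) fun j _ _ => hf j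

theorem csum_le {x S : ℝ} (hx : 0 ≤ x) (hS1 : 1 ≤ S) (hS : 1 + x ^ 2 * S ^ 2 ≤ S) (N : ℕ) :
    ∑ r ∈ Finset.range N, cc r * x ^ r ≤ S := by
  induction N using Nat.strong_induction_on with
  | _ N ih =>
    match N with
    | 0 => simp; linarith
    | 1 => simpa [cc_zero] using hS1
    | N + 2 =>
      rw [Finset.sum_range_succ', Finset.sum_range_succ']
      simp only [zero_add, cc_one, cc_zero, zero_mul, add_zero, pow_zero, mul_one]
      have h1 : ∑ k ∈ Finset.range N, cc (k + 1 + 1) * x ^ (k + 1 + 1) =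
          x ^ 2 * ∑ p ∈ Finset.range N, ∑ i ∈ Finset.range (p + 1),
            (cc (p - i) * x ^ (p - i)) * (cc i * x ^ i) := by
        rw [Finset.mul_sum]
        refine Finset.sum_congr rfl fun p _ => ?_
        rw [show p + 1 + 1 = p + 2 from rfl, cc_rec, Finset.sum_mul, Finset.mul_sum]
        refine Finset.sum_congr rfl fun i hi => ?_
        have := Finset.mem_range.1 hi
        have e : x ^ (p + 2) = x ^ 2 * (x ^ (p - i) * x ^ i) := by
          rw [← pow_add, ← pow_add]; congr 1; omega
        rw [e]; ring
      have h2 := conv_le_sq (fun r => cc r * x ^ r)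
        (fun i => mul_nonneg (cc_nonneg i) (pow_nonneg hx i)) N
      have h3 := ih N (by omega)
      have h4 : 0 ≤ ∑ r ∈ Finset.range N, cc r * x ^ r :=
        Finset.sum_nonneg fun i _ => mul_nonneg (cc_nonneg i) (pow_nonneg hx i)
      have h5 := pow_le_pow_left₀ h4 h3 2
      rw [h1]
      have := mul_le_mul_of_nonneg_left (h2.trans h5) (sq_nonneg x)
      linarith

theorem csum_w {w Λ : ℝ} (hw : 1 ≤ w) (hΛ : w + w⁻¹ ≤ Λ) (N : ℕ) :
    ∑ r ∈ Finset.range N, cc r * (Λ⁻¹) ^ r ≤ 1 + (w⁻¹) ^ 2 := by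
  have hw0 : 0 < w := by linarith
  have hwi : 0 < w⁻¹ := inv_pos.2 hw0
  have hl : 0 < w + w⁻¹ := by positivity
  have h0 : 0 < Λ := lt_of_lt_of_le hl hΛ
  refine csum_le (inv_nonneg.2 h0.le) (by nlinarith) ?_ N
  have h1 : Λ⁻¹ ≤ (w + w⁻¹)⁻¹ := inv_anti₀ hl hΛ
  have h2 : (Λ⁻¹) ^ 2 ≤ ((w + w⁻¹)⁻¹) ^ 2 := pow_le_pow_left₀ (inv_nonneg.2 h0.le) h1 2
  have e : ((w + w⁻¹)⁻¹) ^ 2 * (1 + (w⁻¹) ^ 2) ^ 2 = (w⁻¹) ^ 2 := by field_simp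
  have := mul_le_mul_of_nonneg_right h2 (sq_nonneg (1 + (w⁻¹) ^ 2))
  linarith

theorem cc_le (r : ℕ) : cc r ≤ 2 * 2 ^ r := by
  have h := csum_w (w := 1) (Λ := 2) le_rfl (by norm_num) (r + 1)
  have h1 := Finset.single_le_sum (f := fun r => cc r * (2⁻¹ : ℝ) ^ r)
    (fun i _ => mul_nonneg (cc_nonneg i) (by positivity)) (Finset.mem_range.2 (Nat.lt_succ_self r))
  have h2 : cc r * (2⁻¹ : ℝ) ^ r ≤ 2 := by
    refine h1.trans (h.trans (by norm_num))
  rw [inv_pow, ← div_eq_mul_inv, div_le_iff₀ (by positivity)] at h2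
  exact h2

section S1
variable {n : ℕ}

theorem cs_int {W : Type*} [NormedAddCommGroup W] [NormedSpace ℝ W] [MeasurableSpace W]
    [BorelSpace W] [SecondCountableTopology W] [CompleteSpace W] (ν : Measure W) [IsGaussian ν]
    {f g : W → ℝ} (hf : PG f) (hg : PG g) {a b : ℝ} (ha : 0 ≤ a) (hb : 0 ≤ b)
    (h1 : ∫ x, f x ^ 2 ∂ν ≤ a ^ 2) (h2 : ∫ x, g x ^ 2 ∂ν ≤ b ^ 2) :
    ∫ x, f x * g x ∂ν ≤ a * b := by
  set F := ∫ x, f x ^ 2 ∂ν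
  set K := ∫ x, g x ^ 2 ∂ν
  set I := ∫ x, f x * g x ∂ν
  have hF : 0 ≤ F := integral_nonneg fun x => sq_nonneg _
  have hK : 0 ≤ K := integral_nonneg fun x => sq_nonneg _
  have hq : ∀ t : ℝ, 0 ≤ F * (t * t) + (2 * I) * t + K := by
    intro t
    have h : 0 ≤ ∫ x, (t * f x + g x) ^ 2 ∂ν := integral_nonneg fun x => sq_nonneg _
    have e : ∀ x, (t * f x + g x) ^ 2 = t ^ 2 * f x ^ 2 + 2 * t * (f x * g x) + g x ^ 2 :=
      fun x => by ring
    simp only [e] at h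
    have i1 : Integrable (fun x => t ^ 2 * f x ^ 2) ν := ((hf.pow 2).integrable ν).const_mul _
    have i2 : Integrable (fun x => 2 * t * (f x * g x)) ν := ((hf.mul hg).integrable ν).const_mul _
    have i3 : Integrable (fun x => g x ^ 2) ν := (hg.pow 2).integrable ν
    have i12 : Integrable (fun x => t ^ 2 * f x ^ 2 + 2 * t * (f x * g x)) ν := i1.add i2
    rw [integral_add i12 i3, integral_add i1 i2, integral_const_mul,
      integral_const_mul] at h
    change 0 ≤ t ^ 2 * F + 2 * t * I + K at h
    linarith
  have hd := discrim_le_zero hq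
  unfold discrim at hd
  have h3 : I ^ 2 ≤ (a * b) ^ 2 := by
    have : F * K ≤ a ^ 2 * b ^ 2 := mul_le_mul h1 h2 hK (sq_nonneg a)
    nlinarith
  exact (abs_le_of_sq_le_sq' h3 (by positivity)).2

/-- mean powers -/
noncomputable def mp (ν : Measure (MM n)) (r : ℕ) : MM n := ∫ A, A ^ r ∂ν

theorem fluct_sq {ν : Measure (MM n)} {ε G δ : ℝ} (h : GM ν ε) (hδ : 24 * ε ≤ δ ^ 2) (r : ℕ)
    (hm : ∫ A, ‖A‖ ^ (2 * (r - 1)) ∂ν ≤ 2 * G ^ (2 * (r - 1))) :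
    2 * ∫ A, ‖KK ν (A ^ r - mp ν r)‖ ^ 2 ∂ν ≤ (δ * r * G ^ (r - 1)) ^ 2 := by
  have h1 := kk_fluct h r
  have hε := h.eps
  have h2 : 6 * ε * r ^ 2 * ∫ A, ‖A‖ ^ (2 * (r - 1)) ∂ν
      ≤ 6 * ε * r ^ 2 * (2 * G ^ (2 * (r - 1))) := mul_le_mul_of_nonneg_left hm (by positivity)
  have h3 : 24 * ε * (r ^ 2 * (G ^ (r - 1)) ^ 2) ≤ δ ^ 2 * (r ^ 2 * (G ^ (r - 1)) ^ 2) :=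
    mul_le_mul_of_nonneg_right hδ (by positivity)
  have e : G ^ (2 * (r - 1)) = (G ^ (r - 1)) ^ 2 := by rw [mul_comm, pow_mul]
  rw [e] at h2
  unfold mp
  nlinarith

theorem b_rec {ν : Measure (MM n)} {ε G δ : ℝ} (h : GM ν ε) (hδ0 : 0 ≤ δ) (hδ : 24 * ε ≤ δ ^ 2)
    (hG : 1 ≤ G) (r s : ℕ)
    (hm1 : ∫ A, ‖A‖ ^ (2 * (r - 1)) ∂ν ≤ 2 * G ^ (2 * (r - 1)))
    (hm2 : ∫ A, ‖A‖ ^ (2 * s) ∂ν ≤ 2 * G ^ (2 * s))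
    {b b' : ℝ} (hb : ‖mp ν r - cc r • 1‖ ≤ b) (hb' : ‖mp ν s - cc s • 1‖ ≤ b') :
    ‖(∫ A, KK ν (A ^ r) * A ^ s ∂ν) - (cc r * cc s) • (1 : MM n)‖ ≤
      ((1 + ε) * b + ε * cc r) * (cc s + b') + cc r * b' + δ * r * G ^ (r + s) := by
  have := h.gauss
  have hε := h.eps
  have hcr := cc_nonneg r
  have hcs := cc_nonneg s
  have pgK : PG (fun A : MM n => KK ν (A ^ r - mp ν r)) :=
    PG.KK ν ((PG.id.pow r).sub (PG.const _))
  have split : ∫ A, KK ν (A ^ r) * A ^ s ∂ν =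
      KK ν (mp ν r) * mp ν s + ∫ A, KK ν (A ^ r - mp ν r) * A ^ s ∂ν := by
    have e : ∀ A : MM n, KK ν (A ^ r) * A ^ s =
        KK ν (mp ν r) * A ^ s + KK ν (A ^ r - mp ν r) * A ^ s := by
      intro A; rw [KK_sub]; noncomm_ring
    simp only [e]
    rw [integral_add]
    · congr 1
      exact (ContinuousLinearMap.mul ℝ (MM n) (KK ν (mp ν r))).integral_comp_comm
        ((PG.id.pow s).integrable ν)
    · exact ((PG.const _).mul (PG.id.pow s)).integrable ν
    · exact (pgK.mul (PG.id.pow s)).integrable ν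
  have err : ‖∫ A, KK ν (A ^ r - mp ν r) * A ^ s ∂ν‖ ≤ δ * r * G ^ (r + s) := by
    have h1 : ‖∫ A, KK ν (A ^ r - mp ν r) * A ^ s ∂ν‖ ≤
        ∫ A, ‖KK ν (A ^ r - mp ν r)‖ * ‖A‖ ^ s ∂ν := by
      refine (norm_integral_le_integral_norm _).trans ?_
      refine integral_mono ((pgK.mul (PG.id.pow s)).norm.integrable ν)
        ((pgK.norm.mul (PG.id.norm.pow s)).integrable ν) fun A => ?_
      refine (norm_mul_le _ _).trans ?_
      exact mul_le_mul_of_nonneg_left (norm_pow_le_all A s) (norm_nonneg _)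
    have h2 : ∫ A, ‖KK ν (A ^ r - mp ν r)‖ * ‖A‖ ^ s ∂ν ≤
        (δ * r * G ^ (r - 1) / Real.sqrt 2) * (Real.sqrt 2 * G ^ s) := by
      refine cs_int ν pgK.norm (PG.id.norm.pow s) (by positivity) (by positivity) ?_ ?_
      · have := fluct_sq h hδ r hm1
        rw [div_pow, Real.sq_sqrt zero_le_two]
        linarith
      · rw [mul_pow, Real.sq_sqrt zero_le_two, ← pow_mul, mul_comm s 2]
        refine le_trans (le_of_eq ?_) hm2
        refine integral_congr_ae (Eventually.of_forall fun A => ?_)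
        simp only [← pow_mul, mul_comm s 2]
    have e : (δ * r * G ^ (r - 1) / Real.sqrt 2) * (Real.sqrt 2 * G ^ s) =
        δ * r * (G ^ (r - 1) * G ^ s) := by
      have : Real.sqrt 2 ≠ 0 := by positivity
      field_simp
    rw [e, ← pow_add] at h2
    refine h1.trans (h2.trans ?_)
    refine mul_le_mul_of_nonneg_left (pow_le_pow_right₀ hG (by omega)) (by positivity)
  have k1 : ‖KK ν (mp ν r) - cc r • 1‖ ≤ (1 + ε) * b + ε * cc r := by
    have e : KK ν (mp ν r) - cc r • 1 = KK ν (mp ν r - cc r • 1) + cc r • (KK ν 1 - 1) := by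
      rw [KK_sub, KK_smul, smul_sub]; abel
    rw [e]
    refine (norm_add_le _ _).trans (add_le_add ?_ ?_)
    · exact (KK_norm h _).trans (mul_le_mul_of_nonneg_left hb (by positivity))
    · rw [norm_smul, Real.norm_eq_abs, abs_of_nonneg hcr, mul_comm]
      exact mul_le_mul_of_nonneg_right h.h1 hcr
  have k2 : ‖mp ν s‖ ≤ cc s + b' := by
    calc ‖mp ν s‖ = ‖cc s • (1 : MM n) + (mp ν s - cc s • 1)‖ := by congr 1; abel
      _ ≤ ‖cc s • (1 : MM n)‖ + ‖mp ν s - cc s • 1‖ := norm_add_le _ _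
      _ ≤ cc s + b' := by
        refine add_le_add ?_ hb'
        rw [norm_smul, Real.norm_eq_abs, abs_of_nonneg hcs]
        exact mul_le_of_le_one_right hcs norm_one_le
  have fin : (∫ A, KK ν (A ^ r) * A ^ s ∂ν) - (cc r * cc s) • (1 : MM n) =
      (KK ν (mp ν r) - cc r • 1) * mp ν s + cc r • (mp ν s - cc s • 1) +
        ∫ A, KK ν (A ^ r - mp ν r) * A ^ s ∂ν := by
    rw [split, sub_mul, smul_mul_assoc, one_mul, smul_sub, smul_smul]; abel
  rw [fin]
  refine (norm_add_le _ _).trans (add_le_add ((norm_add_le _ _).trans (add_le_add ?_ ?_)) err)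
  · refine (norm_mul_le _ _).trans ?_
    exact mul_le_mul k1 k2 (norm_nonneg _) ((norm_nonneg _).trans k1)
  · rw [norm_smul, Real.norm_eq_abs, abs_of_nonneg hcr]
    exact mul_le_mul_of_nonneg_left hb' hcr

theorem step1 {ν : Measure (MM n)} {ε G δ B θ S : ℝ} (h : GM ν ε) (hδ0 : 0 ≤ δ)
    (hδ : 24 * ε ≤ δ ^ 2) (Q : ℕ) (hG : 2 ≤ G)
    (hm : ∀ t ≤ Q, ∫ A, ‖A‖ ^ (2 * t) ∂ν ≤ 2 * G ^ (2 * t))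
    (hS : ∀ N, ∑ r ∈ Finset.range N, cc r * (G⁻¹) ^ r ≤ S) (hS2 : S ≤ 2)
    (hGS : 2 * S + 4 * θ ≤ G ^ 2) (hB0 : 0 ≤ B) (hB1 : B ≤ 1) (hε1 : ε ≤ 1)
    (c1 : 8 * ε ≤ θ * B) (c2 : 2 * B * Q ≤ θ) (c3 : δ * Q ^ 2 ≤ θ * B) :
    ∀ p ≤ Q, ‖mp ν p - cc p • 1‖ ≤ B * G ^ p := by
  have := h.gauss
  have hε := h.eps
  have hG0 : 0 < G := by linarith
  intro p
  induction p using Nat.strong_induction_on with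
  | _ p ih =>
    intro hp
    match p, hp, ih with
    | 0, _, _ => simp [mp, cc_zero]; exact hB0
    | 1, _, _ =>
      have : mp ν 1 = 0 := by simpa [mp] using h.mean
      rw [this, cc_one]; simp; positivity
    | p + 2, hp, ih =>
      set C : ℕ → ℝ := fun r => cc r * (G⁻¹) ^ r with hC
      have hC0 : ∀ r, 0 ≤ C r := fun r => mul_nonneg (cc_nonneg r) (by positivity)
      have hCS : ∀ r, C r ≤ S := fun r =>
        (Finset.single_le_sum (f := C) (fun i _ => hC0 i)
          (Finset.mem_range.2 (Nat.lt_succ_self r))).trans (hS (r + 1))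
      have hS0 : 0 ≤ S := (hC0 0).trans (hCS 0)
      have hcC : ∀ r, cc r = C r * G ^ r := fun r => by
        simp only [hC]; rw [mul_assoc, ← mul_pow, inv_mul_cancel₀ hG0.ne', one_pow, mul_one]
      have e1 : mp ν (p + 2) - cc (p + 2) • 1 = ∑ i ∈ Finset.range (p + 1),
          ((∫ A, KK ν (A ^ (p - i)) * A ^ i ∂ν) - (cc (p - i) * cc i) • (1 : MM n)) := by
        rw [Finset.sum_sub_distrib, ← Finset.sum_smul, ← cc_rec, ← ibp_pow h]; rfl
      have term : ∀ i ∈ Finset.range (p + 1),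
          ‖(∫ A, KK ν (A ^ (p - i)) * A ^ i ∂ν) - (cc (p - i) * cc i) • (1 : MM n)‖ ≤
          G ^ p * ((1 + ε) * B * C i + (1 + ε) * B ^ 2 + ε * S * C i + ε * B * C (p - i)
            + B * C (p - i) + δ * Q) := by
        intro i hi
        have hi' : i ≤ p := Nat.lt_succ_iff.1 (Finset.mem_range.1 hi)
        have h1 := b_rec h hδ0 hδ (by linarith) (p - i) i (hm _ (by omega)) (hm _ (by omega))
          (ih (p - i) (by omega) (by omega)) (ih i (by omega) (by omega))
        refine h1.trans ?_
        rw [hcC (p - i), hcC i]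
        have eG : G ^ p = G ^ (p - i) * G ^ i := by rw [← pow_add]; congr 1; omega
        have eG' : G ^ (p - i + i) = G ^ (p - i) * G ^ i := pow_add _ _ _
        rw [eG, eG']
        set x := G ^ (p - i)
        set y := G ^ i
        have hx : 0 ≤ x := by positivity
        have hy : 0 ≤ y := by positivity
        have hxy := mul_nonneg hx hy
        have hq : ((p - i : ℕ) : ℝ) ≤ Q := by exact_mod_cast (by omega)
        have i1 : δ * ((p - i : ℕ) : ℝ) * (x * y) ≤ x * y * (δ * Q) := by
          rw [mul_comm (x * y)]
          exact mul_le_mul_of_nonneg_right (mul_le_mul_of_nonneg_left hq hδ0) hxy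
        have i2 : ε * C (p - i) * C i ≤ ε * S * C i :=
          mul_le_mul_of_nonneg_right (mul_le_mul_of_nonneg_left (hCS _) hε) (hC0 i)
        have i3 := mul_le_mul_of_nonneg_left i2 hxy
        nlinarith
      rw [e1]
      refine (norm_sum_le _ _).trans ((Finset.sum_le_sum term).trans ?_)
      rw [← Finset.mul_sum]
      simp only [Finset.sum_add_distrib, ← Finset.mul_sum]
      have s1 : ∑ i ∈ Finset.range (p + 1), C i ≤ S := hS (p + 1)
      have s2 : ∑ i ∈ Finset.range (p + 1), C (p - i) ≤ S := by
        have := Finset.sum_range_reflect C (p + 1)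
        simp only [Nat.add_sub_cancel] at this
        have e : ∑ i ∈ Finset.range (p + 1), C (p - i) =
            ∑ j ∈ Finset.range (p + 1), C (p + 1 - 1 - j) := by simp
        rw [e, Finset.sum_range_reflect]; exact hS (p + 1)
      set X := ∑ i ∈ Finset.range (p + 1), C i
      set Y := ∑ i ∈ Finset.range (p + 1), C (p - i)
      simp only [Finset.sum_const, Finset.card_range, nsmul_eq_mul]
      have hpQ : ((p + 1 : ℕ) : ℝ) ≤ Q := by exact_mod_cast (by omega)
      have hQ0 : (0:ℝ) ≤ Q := Nat.cast_nonneg _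
      have main : (1 + ε) * B * X + ((p + 1 : ℕ) : ℝ) * ((1 + ε) * B ^ 2) + ε * S * X + ε * B * Y
          + B * Y + ((p + 1 : ℕ) : ℝ) * (δ * Q) ≤ B * G ^ 2 := by
        have t1 : (1 + ε) * B * X ≤ (1 + ε) * B * S := by gcongr
        have t2 : ((p + 1 : ℕ) : ℝ) * ((1 + ε) * B ^ 2) ≤ Q * (2 * B ^ 2) := by
          gcongr; linarith
        have t3 : ε * S * X ≤ ε * 4 := by
          have : S * X ≤ 4 := by nlinarith
          rw [mul_assoc]; exact mul_le_mul_of_nonneg_left this hε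
        have t4 : ε * B * Y ≤ ε * B * S := by gcongr
        have t5 : B * Y ≤ B * S := by gcongr
        have t6 : ((p + 1 : ℕ) : ℝ) * (δ * Q) ≤ Q * (δ * Q) := by gcongr
        have t7 : ε * B * S ≤ ε * 2 := by
          have : B * S ≤ 2 := by nlinarith
          rw [mul_assoc]; exact mul_le_mul_of_nonneg_left this hε
        have t8 : B * (2 * B * Q) ≤ B * θ := mul_le_mul_of_nonneg_left c2 hB0
        have t9 : B * (2 * S + 4 * θ) ≤ B * G ^ 2 := mul_le_mul_of_nonneg_left hGS hB0
        nlinarith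
      calc G ^ p * _ ≤ G ^ p * (B * G ^ 2) :=
            mul_le_mul_of_nonneg_left (le_trans (le_of_eq (by ring)) main) (by positivity)
        _ = B * G ^ (p + 2) := by ring
end S1

end PartS1

section PartS2
open MeasureTheory ProbabilityTheory Filter Topology
open scoped Matrix.Norms.L2Operator

section S2
variable {n : ℕ}

theorem trace_even_nonneg {A : MM n} (hA : A.IsHermitian) {p : ℕ} (hp : Even p) :
    0 ≤ (A ^ p).trace := by
  rw [trace_pow_eq hA]; exact Finset.sum_nonneg fun i _ => hp.pow_nonneg _

theorem trace_two_mul_le {A : MM n} (hA : A.IsHermitian) {p : ℕ} (hp : Even p) :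
    (A ^ (2 * p)).trace ≤ (A ^ p).trace ^ 2 := by
  rw [trace_pow_eq hA, trace_pow_eq hA]
  have := Finset.sum_sq_le_sq_sum_of_nonneg (s := Finset.univ)
    (f := fun i => hA.eigenvalues i ^ p) (fun i _ => hp.pow_nonneg _)
  refine le_trans (le_of_eq ?_) this
  refine Finset.sum_congr rfl fun i _ => ?_
  rw [← pow_mul, mul_comm]

theorem pow_interp (x : ℝ) {p : ℕ} (hp : Even p) :
    x ^ (2 * (p - 1)) ≤ x ^ (2 * p) + x ^ p := by
  have h0 : 0 ≤ x ^ p := hp.pow_nonneg _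
  have h1 : 0 ≤ x ^ (2 * p) := (even_two_mul p).pow_nonneg _
  rcases Nat.eq_zero_or_pos p with rfl | hp0
  · simp
  have hp2 : 2 ≤ p := by obtain ⟨k, rfl⟩ := hp; omega
  rw [← (even_two_mul (p - 1)).pow_abs, ← (even_two_mul p).pow_abs, ← hp.pow_abs]
  rw [← hp.pow_abs] at h0
  rw [← (even_two_mul p).pow_abs] at h1
  rcases le_total 1 |x| with hx | hx
  · have := pow_le_pow_right₀ hx (show 2 * (p - 1) ≤ 2 * p by omega)
    linarith
  · have := pow_le_pow_of_le_one (abs_nonneg x) hx (show p ≤ 2 * (p - 1) by omega)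
    linarith

theorem step0 {ν : Measure (MM n)} {ε κ : ℝ} (h : GM ν ε) (hn : 1 ≤ n) (hκ : 1 ≤ κ) {p : ℕ}
    (hp : Even p) (hT : ∫ A, (A ^ p).trace ∂ν ≤ n * κ ^ p) (hε : 2 * ε * p ^ 2 ≤ 1 / 4) :
    ∫ A, (A ^ p).trace ^ 2 ∂ν ≤ 2 * (n * κ ^ p) ^ 2 := by
  have := h.gauss
  have hX : PG (fun A : MM n => (A ^ p).trace) := (PG.id.pow p).trace
  set m := ∫ A, (A ^ p).trace ∂ν with hm
  have hm0 : 0 ≤ m := integral_nonneg_of_ae (by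
    filter_upwards [h.herm] with A hA using trace_even_nonneg hA hp)
  set V := ∫ A, (A ^ p).trace ^ 2 ∂ν with hV
  have iX := hX.integrable ν
  have iX2 := (hX.pow 2).integrable ν
  have e1 : ∫ A, ((A ^ p).trace - m) ^ 2 ∂ν = V - m ^ 2 := by
    have e : ∀ A : MM n, ((A ^ p).trace - m) ^ 2 = (A ^ p).trace ^ 2 - (2 * m) * (A ^ p).trace + m ^ 2 :=
      fun A => by ring
    simp only [e]
    have i12 : Integrable (fun A : MM n => (A ^ p).trace ^ 2 - (2 * m) * (A ^ p).trace) ν :=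
      iX2.sub (iX.const_mul _)
    rw [integral_add i12 (integrable_const _), integral_sub iX2 (iX.const_mul _),
      integral_const_mul, integral_const, ← hV, ← hm]
    simp; ring
  have v := var_trace_one h p
  rw [← hm, e1] at v
  have e2 : ∫ A, (A ^ (2 * (p - 1))).trace ∂ν ≤ V + m := by
    rw [hV, hm, ← integral_add iX2 iX]
    refine integral_mono_ae ((PG.id.pow _).trace.integrable ν) (iX2.add iX) ?_
    filter_upwards [h.herm] with A hA
    refine le_trans ?_ (add_le_add_left (trace_two_mul_le hA hp) _)
    rw [trace_pow_eq hA, trace_pow_eq hA, trace_pow_eq hA, ← Finset.sum_add_distrib]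
    exact Finset.sum_le_sum fun i _ => pow_interp _ hp
  have hV0 : 0 ≤ V := integral_nonneg fun A => sq_nonneg _
  have e3 : 2 * ε * p ^ 2 * ∫ A, (A ^ (2 * (p - 1))).trace ∂ν ≤ 1 / 4 * (V + m) := by
    have hε0 := h.eps
    calc _ ≤ 2 * ε * p ^ 2 * (V + m) := mul_le_mul_of_nonneg_left e2 (by positivity)
      _ ≤ _ := mul_le_mul_of_nonneg_right hε (by positivity)
  set M := (n : ℝ) * κ ^ p
  have hM : 1 ≤ M := by
    have : (1:ℝ) ≤ n := by exact_mod_cast hn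
    have h2 : (1:ℝ) ≤ κ ^ p := one_le_pow₀ hκ
    exact one_le_mul_of_one_le_of_one_le this h2
  nlinarith

theorem tau_ex {ν : Measure (MM n)} {ε κ : ℝ} (h : GM ν ε) (hn : 1 ≤ n) (hκ : 1 ≤ κ) {P : ℕ}
    (hP : Even P) (hT : ∀ q ≤ P, Even q → ∫ A, (A ^ q).trace ∂ν ≤ n * κ ^ q)
    (hε : 2 * ε * P ^ 2 ≤ 1 / 4) {s : ℕ} (hs : s ≤ P) :
    ∃ τ : MM n → ℝ, PG τ ∧
      (∀ A : MM n, A.IsHermitian → ∀ M : MM n, |(M * A ^ s).trace| ≤ ‖M‖ * τ A) ∧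
      (∀ A : MM n, A.IsHermitian → 0 ≤ τ A) ∧
      ∫ A, τ A ∂ν ≤ n * κ ^ s ∧ ∫ A, τ A ^ 2 ∂ν ≤ 2 * (n * κ ^ s) ^ 2 := by
  have := h.gauss
  have hε0 := h.eps
  have hκ0 : 0 < κ := by linarith
  have hεq : ∀ q ≤ P, 2 * ε * (q:ℝ) ^ 2 ≤ 1 / 4 := fun q hq => by
    refine le_trans ?_ hε
    have : (q:ℝ) ≤ P := by exact_mod_cast hq
    gcongr
  have hX : ∀ p, PG (fun A : MM n => (A ^ p).trace) := fun p => (PG.id.pow p).trace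
  rcases Nat.even_or_odd s with he | ho
  · refine ⟨fun A => (A ^ s).trace, hX s, ?_, ?_, hT s hs he, step0 h hn hκ he (hT s hs he) (hεq s hs)⟩
    · intro A hA M
      refine (abs_trace_mul_pow_le hA M s).trans (le_of_eq ?_)
      simp only [trace_pow_eq hA, he.pow_abs]
    · intro A hA; exact trace_even_nonneg hA he
  · obtain ⟨k, rfl⟩ := ho
    have h2 : 2 * k + 2 ≤ P := by obtain ⟨l, rfl⟩ := hP; omega
    have ev1 : Even (2 * k) := even_two_mul k
    have ev2 : Even (2 * k + 2) := ⟨k + 1, by ring⟩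
    have t1 := hT (2 * k) (by omega) ev1
    have t2 := hT (2 * k + 2) h2 ev2
    have s1 := step0 h hn hκ ev1 t1 (hεq _ (by omega))
    have s2 := step0 h hn hκ ev2 t2 (hεq _ h2)
    have i1 := (hX (2 * k)).integrable ν
    have i2 := (hX (2 * k + 2)).integrable ν
    have j1 := ((hX (2 * k)).pow 2).integrable ν
    have j2 := ((hX (2 * k + 2)).pow 2).integrable ν
    have pgt : PG (fun A : MM n => κ / 2 * (A ^ (2 * k)).trace + κ⁻¹ / 2 * (A ^ (2 * k + 2)).trace) :=
      ((PG.const _).mul (hX _)).add ((PG.const _).mul (hX _))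
    refine ⟨fun A => κ / 2 * (A ^ (2 * k)).trace + κ⁻¹ / 2 * (A ^ (2 * k + 2)).trace, pgt,
      ?_, ?_, ?_, ?_⟩
    · intro A hA M
      refine (abs_trace_mul_pow_le hA M _).trans ?_
      refine mul_le_mul_of_nonneg_left ?_ (norm_nonneg _)
      simp only [trace_pow_eq hA]
      rw [Finset.mul_sum, Finset.mul_sum, ← Finset.sum_add_distrib]
      refine Finset.sum_le_sum fun i _ => ?_
      rw [← ev1.pow_abs, ← ev2.pow_abs]
      set x := |hA.eigenvalues i|
      have hx : 0 ≤ x := abs_nonneg _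
      have e : κ / 2 * x ^ (2 * k) + κ⁻¹ / 2 * x ^ (2 * k + 2) - x ^ (2 * k + 1) =
          x ^ (2 * k) * (κ⁻¹ / 2) * (x - κ) ^ 2 := by
        have : κ⁻¹ * κ = 1 := inv_mul_cancel₀ hκ0.ne'
        have h3 : κ = κ⁻¹ * κ ^ 2 := by field_simp
        have h4 : x ^ (2 * k + 1) = x ^ (2 * k) * (κ⁻¹ * κ) * x := by rw [this]; ring
        rw [h4]
        nth_rewrite 1 [h3]
        ring
      have : 0 ≤ x ^ (2 * k) * (κ⁻¹ / 2) * (x - κ) ^ 2 := by positivity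
      linarith
    · intro A hA
      have a1 := trace_even_nonneg hA ev1
      have a2 := trace_even_nonneg hA ev2
      positivity
    · rw [integral_add (i1.const_mul _) (i2.const_mul _), integral_const_mul, integral_const_mul]
      have a1 := mul_le_mul_of_nonneg_left t1 (show 0 ≤ κ / 2 by positivity)
      have a2 := mul_le_mul_of_nonneg_left t2 (show 0 ≤ κ⁻¹ / 2 by positivity)
      have e1 : κ / 2 * (n * κ ^ (2 * k)) = n * κ ^ (2 * k + 1) / 2 := by ring
      have e2 : κ⁻¹ / 2 * (n * κ ^ (2 * k + 2)) = n * κ ^ (2 * k + 1) / 2 := by field_simp; ring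
      linarith
    · have b1 : ∫ A, (κ / 2 * (A ^ (2 * k)).trace + κ⁻¹ / 2 * (A ^ (2 * k + 2)).trace) ^ 2 ∂ν ≤
          ∫ A, (κ ^ 2 / 2 * (A ^ (2 * k)).trace ^ 2 + (κ⁻¹) ^ 2 / 2 * (A ^ (2 * k + 2)).trace ^ 2) ∂ν := by
        refine integral_mono ((pgt.pow 2).integrable ν)
          ((j1.const_mul _).add (j2.const_mul _)) fun A => ?_
        have := sq_nonneg (κ * (A ^ (2 * k)).trace - κ⁻¹ * (A ^ (2 * k + 2)).trace)
        simp only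
        nlinarith
      refine b1.trans ?_
      rw [integral_add (j1.const_mul _) (j2.const_mul _), integral_const_mul, integral_const_mul]
      have a1 := mul_le_mul_of_nonneg_left s1 (show 0 ≤ κ ^ 2 / 2 by positivity)
      have a2 := mul_le_mul_of_nonneg_left s2 (show 0 ≤ (κ⁻¹) ^ 2 / 2 by positivity)
      have e1 : κ ^ 2 / 2 * (2 * (n * κ ^ (2 * k)) ^ 2) = (n * κ ^ (2 * k + 1)) ^ 2 := by ring
      have e2 : (κ⁻¹) ^ 2 / 2 * (2 * (n * κ ^ (2 * k + 2)) ^ 2) = (n * κ ^ (2 * k + 1)) ^ 2 := by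
        field_simp; ring
      linarith

/-- the two-point functions -/
noncomputable def phi (ν : Measure (MM n)) (r s : ℕ) : ℝ := ∫ A, (KK ν (A ^ r) * A ^ s).trace ∂ν

theorem KK_trace {ν : Measure (MM n)} [IsGaussian ν] (A B : MM n) :
    (KK ν A * B).trace = ∫ H, (H * A * H * B).trace ∂ν := by
  have h1 : KK ν A * B = ∫ H, H * A * H * B ∂ν :=
    (((ContinuousLinearMap.mul ℝ (MM n)).flip B).integral_comp_comm ((pgHAH A).integrable ν)).symm
  rw [h1]
  exact (trL.integral_comp_comm (((pgHAH A).mul (PG.const B)).integrable ν)).symm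

theorem phi_symm {ν : Measure (MM n)} [IsGaussian ν] (r s : ℕ) : phi ν r s = phi ν s r := by
  unfold phi
  refine integral_congr_ae (Eventually.of_forall fun A => ?_)
  simp only [KK_trace]
  refine integral_congr_ae (Eventually.of_forall fun H => ?_)
  simp only
  rw [Matrix.mul_assoc (H * A ^ r), Matrix.trace_mul_comm, ← Matrix.mul_assoc]

theorem pow_mix (x y : ℝ) {R S r s : ℕ} (hR : Even R) (hS : Even S) (hr : R ≤ r) (hs : R ≤ s)
    (e : r + s = R + S) :
    x ^ r * y ^ s + x ^ s * y ^ r ≤ x ^ R * y ^ S + x ^ S * y ^ R := by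
  obtain ⟨a, rfl⟩ := Nat.exists_eq_add_of_le hr
  obtain ⟨b, rfl⟩ := Nat.exists_eq_add_of_le hs
  have hS' : S = R + (a + b) := by omega
  have hab : Even (a + b) := by
    obtain ⟨u, hu⟩ := hR; obtain ⟨v, hv⟩ := hS; exact ⟨v - u, by omega⟩
  subst hS'
  have e1 : ∀ x y : ℝ, x ^ (R + a) * y ^ (R + b) ≤ (x * y) ^ R * (|x| ^ a * |y| ^ b) := by
    intro x y
    have : x ^ (R + a) * y ^ (R + b) = (x * y) ^ R * (x ^ a * y ^ b) := by ring
    rw [this]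
    refine mul_le_mul_of_nonneg_left ?_ (hR.pow_nonneg _)
    rw [← abs_pow, ← abs_pow, ← abs_mul]; exact le_abs_self _
  have h1 := e1 x y
  have h2 := e1 y x
  have e2 : x ^ R * y ^ (R + (a + b)) + x ^ (R + (a + b)) * y ^ R =
      (x * y) ^ R * (|y| ^ (a + b) + |x| ^ (a + b)) := by
    rw [hab.pow_abs, hab.pow_abs]; ring
  rw [e2]
  have key : |x| ^ a * |y| ^ b + |y| ^ a * |x| ^ b ≤ |y| ^ (a + b) + |x| ^ (a + b) := by
    have : 0 ≤ (|x| ^ a - |y| ^ a) * (|x| ^ b - |y| ^ b) := by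
      rcases le_total |x| |y| with hxy | hxy
      · exact mul_nonneg_of_nonpos_of_nonpos (sub_nonpos.2 (pow_le_pow_left₀ (abs_nonneg _) hxy _))
          (sub_nonpos.2 (pow_le_pow_left₀ (abs_nonneg _) hxy _))
      · exact mul_nonneg (sub_nonneg.2 (pow_le_pow_left₀ (abs_nonneg _) hxy _))
          (sub_nonneg.2 (pow_le_pow_left₀ (abs_nonneg _) hxy _))
    rw [pow_add, pow_add]; nlinarith
  have h3 := mul_le_mul_of_nonneg_left key (hR.pow_nonneg (x * y))
  have h4 : x ^ (R + b) * y ^ (R + a) = y ^ (R + a) * x ^ (R + b) := mul_comm _ _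
  rw [h4]
  have h5 : (y * x) ^ R = (x * y) ^ R := by rw [mul_comm]
  rw [h5] at h2
  nlinarith

theorem phi_mid {ν : Measure (MM n)} {ε : ℝ} (h : GM ν ε) {R S r s : ℕ} (hR : Even R)
    (hS : Even S) (hr : R ≤ r) (hs : R ≤ s) (e : r + s = R + S) : phi ν r s ≤ phi ν R S := by
  have := h.gauss
  unfold phi
  have pg : ∀ r s, PG (fun A : MM n => (KK ν (A ^ r) * A ^ s).trace) := fun r s =>
    ((PG.KK ν (PG.id.pow r)).mul (PG.id.pow s)).trace
  refine integral_mono_ae ((pg r s).integrable ν) ((pg R S).integrable ν) ?_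
  filter_upwards [h.herm] with A hA
  rw [KK_trace, KK_trace]
  refine integral_mono_ae (((pgHAH _).mul (PG.const _)).trace.integrable ν)
    (((pgHAH _).mul (PG.const _)).trace.integrable ν) ?_
  filter_upwards [h.herm] with H hH
  obtain ⟨w, hw0, hws, hw⟩ := trace_four hA hH
  have dbl : ∀ r s, 2 * (H * A ^ r * H * A ^ s).trace = ∑ i, ∑ j, w i j *
      (hA.eigenvalues i ^ r * hA.eigenvalues j ^ s + hA.eigenvalues i ^ s * hA.eigenvalues j ^ r) := by
    intro r s
    have h2 : (H * A ^ r * H * A ^ s).trace =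
        ∑ i, ∑ j, w i j * (hA.eigenvalues i ^ s * hA.eigenvalues j ^ r) := by
      rw [hw, Finset.sum_comm]
      refine Finset.sum_congr rfl fun i _ => Finset.sum_congr rfl fun j _ => ?_
      rw [hws]; ring
    rw [two_mul]
    nth_rewrite 1 [hw]
    rw [h2]
    simp only [← Finset.sum_add_distrib, mul_add]
  have : 2 * (H * A ^ r * H * A ^ s).trace ≤ 2 * (H * A ^ R * H * A ^ S).trace := by
    rw [dbl, dbl]
    refine Finset.sum_le_sum fun i _ => Finset.sum_le_sum fun j _ => ?_
    exact mul_le_mul_of_nonneg_left (pow_mix _ _ hR hS hr hs e) (hw0 i j)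
  linarith

theorem T_rec {ν : Measure (MM n)} {ε : ℝ} (h : GM ν ε) (p : ℕ) :
    ∫ A, (A ^ (p + 2)).trace ∂ν = ∑ i ∈ Finset.range (p + 1), phi ν (p - i) i := by
  have := h.gauss
  have h1 : ∫ A, (A ^ (p + 2)).trace ∂ν = trL (∫ A, A ^ (p + 2) ∂ν) :=
    trL.integral_comp_comm ((PG.id.pow _).integrable ν)
  rw [h1, ibp_pow h, map_sum]
  refine Finset.sum_congr rfl fun i _ => ?_
  exact (trL.integral_comp_comm (((PG.KK ν (PG.id.pow _)).mul (PG.id.pow _)).integrable ν)).symm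

theorem phi_le {ν : Measure (MM n)} {ε κ G δ b : ℝ} (h : GM ν ε) (hn : 1 ≤ n) (hκ : 1 ≤ κ)
    (hG : 1 ≤ G) (hδ0 : 0 ≤ δ) (hδ : 24 * ε ≤ δ ^ 2) {P : ℕ}
    (hP : Even P) (hT : ∀ q ≤ P, Even q → ∫ A, (A ^ q).trace ∂ν ≤ n * κ ^ q)
    (hε : 2 * ε * P ^ 2 ≤ 1 / 4) {r s : ℕ} (hs : s ≤ P)
    (hm : ∫ A, ‖A‖ ^ (2 * (r - 1)) ∂ν ≤ 2 * G ^ (2 * (r - 1)))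
    (hb : ‖mp ν r - cc r • 1‖ ≤ b) :
    phi ν r s ≤ ((1 + ε) * (cc r + b) + δ * r * G ^ r) * (n * κ ^ s) := by
  have := h.gauss
  have hε0 := h.eps
  obtain ⟨τ, pgτ, t1, t2, t3, t4⟩ := tau_ex h hn hκ hP hT hε hs
  have k2 : ‖mp ν r‖ ≤ cc r + b := by
    calc ‖mp ν r‖ = ‖cc r • (1 : MM n) + (mp ν r - cc r • 1)‖ := by congr 1; abel
      _ ≤ ‖cc r • (1 : MM n)‖ + ‖mp ν r - cc r • 1‖ := norm_add_le _ _
      _ ≤ cc r + b := by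
        refine add_le_add ?_ hb
        rw [norm_smul, Real.norm_eq_abs, abs_of_nonneg (cc_nonneg r)]
        exact mul_le_of_le_one_right (cc_nonneg r) norm_one_le
  have pgK : PG (fun A : MM n => KK ν (A ^ r - mp ν r)) :=
    PG.KK ν ((PG.id.pow r).sub (PG.const _))
  have hM0 : 0 ≤ (n:ℝ) * κ ^ s := by positivity
  have main : phi ν r s ≤ ∫ A, (((1 + ε) * (cc r + b)) * τ A + ‖KK ν (A ^ r - mp ν r)‖ * τ A) ∂ν := by
    unfold phi
    refine integral_mono_ae (((PG.KK ν (PG.id.pow r)).mul (PG.id.pow s)).trace.integrable ν)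
      ((((PG.const _).mul pgτ).add (pgK.norm.mul pgτ)).integrable ν) ?_
    filter_upwards [h.herm] with A hA
    refine (le_abs_self _).trans ((t1 A hA _).trans ?_)
    rw [← add_mul]
    refine mul_le_mul_of_nonneg_right ?_ (t2 A hA)
    have e : KK ν (A ^ r) = KK ν (mp ν r) + KK ν (A ^ r - mp ν r) := by rw [KK_sub]; abel
    rw [e]
    refine (norm_add_le _ _).trans (add_le_add ?_ le_rfl)
    exact (KK_norm h _).trans (mul_le_mul_of_nonneg_left k2 (by positivity))
  refine main.trans ?_
  rw [integral_add ((pgτ.integrable ν).const_mul _) ((pgK.norm.mul pgτ).integrable ν),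
    integral_const_mul, add_mul ((1 + ε) * (cc r + b))]
  refine add_le_add ?_ ?_
  · have : 0 ≤ (1 + ε) * (cc r + b) := mul_nonneg (by positivity) ((norm_nonneg _).trans k2)
    exact mul_le_mul_of_nonneg_left t3 this
  · have h2 : ∫ A, ‖KK ν (A ^ r - mp ν r)‖ * τ A ∂ν ≤
        (δ * r * G ^ (r - 1) / Real.sqrt 2) * (Real.sqrt 2 * (n * κ ^ s)) := by
      refine cs_int ν pgK.norm pgτ (by positivity) (by positivity) ?_ ?_
      · have := fluct_sq h hδ r hm
        rw [div_pow, Real.sq_sqrt zero_le_two]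
        linarith
      · rw [mul_pow, Real.sq_sqrt zero_le_two]; exact t4
    have e : (δ * r * G ^ (r - 1) / Real.sqrt 2) * (Real.sqrt 2 * (n * κ ^ s)) =
        δ * r * G ^ (r - 1) * (n * κ ^ s) := by
      have : Real.sqrt 2 ≠ 0 := by positivity
      field_simp
    rw [e] at h2
    refine h2.trans (mul_le_mul_of_nonneg_right ?_ hM0)
    exact mul_le_mul_of_nonneg_left (pow_le_pow_right₀ hG (by omega)) (by positivity)
end S2

end PartS2

section PartS3
open MeasureTheory ProbabilityTheory Filter Topology
open scoped Matrix.Norms.L2Operator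

section S3
variable {n : ℕ}

theorem step2 {ν : Measure (MM n)} {ε κ μ δ B θ S : ℝ} (h : GM ν ε) (hn : 1 ≤ n)
    (hδ0 : 0 ≤ δ) (hδ : 24 * ε ≤ δ ^ 2) (hκ : 2 ≤ κ) (hμ : 1 ≤ μ) {P R : ℕ} (hP : Even P)
    (hR : Even R) (hRP : 2 * R ≤ P)
    (hm : ∀ t, 2 * t ≤ P → ∫ A, ‖A‖ ^ (2 * t) ∂ν ≤ 2 * (μ * κ) ^ (2 * t))
    (hSκ : ∀ N, ∑ r ∈ Finset.range N, cc r * (κ⁻¹) ^ r ≤ S)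
    (hSG : ∀ N, ∑ r ∈ Finset.range N, cc r * ((μ * κ)⁻¹) ^ r ≤ S) (hS2 : S ≤ 2)
    (hκS : 2 * S + 4 * θ ≤ κ ^ 2) (hθ : 0 ≤ θ) (hB0 : 0 ≤ B) (hB1 : B ≤ 1) (hε1 : ε ≤ 1)
    (c1 : 8 * ε ≤ θ * B) (c2 : 2 * B * R ≤ θ) (c3 : δ * R ^ 2 ≤ θ * B) (c4 : δ * R ≤ B)
    (c5 : (P + 1) * (3 * B * μ ^ R + 4 * (2 / κ) ^ R) ≤ θ) (c6 : 2 * ε * P ^ 2 ≤ 1 / 4) :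
    ∀ p ≤ P, Even p → ∫ A, (A ^ p).trace ∂ν ≤ n * κ ^ p := by
  have := h.gauss
  have hε := h.eps
  have hκ0 : 0 < κ := by linarith
  have hGκ : κ ≤ μ * κ := le_mul_of_one_le_left hκ0.le hμ
  have b1 := step1 h hδ0 hδ R (by linarith) (fun t ht => hm t (by omega)) hSG hS2
    (hκS.trans (pow_le_pow_left₀ hκ0.le hGκ 2)) hB0 hB1 hε1 c1 c2 c3
  set C : ℕ → ℝ := fun r => cc r * (κ⁻¹) ^ r with hC
  have hC0 : ∀ r, 0 ≤ C r := fun r => mul_nonneg (cc_nonneg r) (by positivity)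
  have hcC : ∀ r, cc r = C r * κ ^ r := fun r => by
    simp only [hC]; rw [mul_assoc, ← mul_pow, inv_mul_cancel₀ hκ0.ne', one_pow, mul_one]
  intro p
  induction p using Nat.strong_induction_on with
  | _ p ih =>
    intro hp hpe
    match p, hp, ih, hpe with
    | 0, _, _, _ => simp
    | 1, _, _, hpe => exact absurd hpe (by decide)
    | p + 2, hp, ih, hpe =>
      have hpe' : Even p := by obtain ⟨k, hk⟩ := hpe; exact ⟨k - 1, by omega⟩
      have ih' : ∀ q ≤ p, Even q → ∫ A, (A ^ q).trace ∂ν ≤ n * κ ^ q := fun q hq he =>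
        ih q (by omega) (by omega) he
      have hpP : (p:ℝ) ≤ P := by exact_mod_cast (by omega)
      have c6' : 2 * ε * (p:ℝ) ^ 2 ≤ 1 / 4 := le_trans (by gcongr) c6
      have low : ∀ r s, r ≤ R → r + s = p →
          phi ν r s ≤ n * κ ^ p * ((1 + ε) * C r + 3 * B * μ ^ R) := by
        intro r s hr hrs
        have h1 := phi_le h hn (by linarith) (by linarith : 1 ≤ μ * κ) hδ0 hδ hpe' ih' c6'
          (show s ≤ p by omega) (hm (r - 1) (by omega)) (b1 r hr)
        refine h1.trans ?_
        have eκ : κ ^ p = κ ^ r * κ ^ s := by rw [← pow_add, hrs]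
        have hn0 : (0:ℝ) ≤ n := Nat.cast_nonneg n
        rw [hcC r, eκ, mul_pow]
        have hμr : μ ^ r ≤ μ ^ R := pow_le_pow_right₀ hμ hr
        have hμ0 : 0 ≤ μ ^ r := by positivity
        have hδr : δ * r ≤ B := by
          have : (r:ℝ) ≤ R := by exact_mod_cast hr
          exact (mul_le_mul_of_nonneg_left this hδ0).trans c4
        have key : (1 + ε) * (C r + B * μ ^ r) + δ * r * μ ^ r ≤
            (1 + ε) * C r + 3 * B * μ ^ R := by
          have a1 : δ * r * μ ^ r ≤ B * μ ^ r := mul_le_mul_of_nonneg_right hδr hμ0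
          have a2 : B * μ ^ r ≤ B * μ ^ R := mul_le_mul_of_nonneg_left hμr hB0
          have a3 : ε * (B * μ ^ r) ≤ 1 * (B * μ ^ r) :=
            mul_le_mul_of_nonneg_right hε1 (by positivity)
          nlinarith
        have := mul_le_mul_of_nonneg_left key (show 0 ≤ (n:ℝ) * (κ ^ r * κ ^ s) by positivity)
        calc _ = (n:ℝ) * (κ ^ r * κ ^ s) * ((1 + ε) * (C r + B * μ ^ r) + δ * r * μ ^ r) := by ring
          _ ≤ _ := this
      set E := 3 * B * μ ^ R + 4 * (2 / κ) ^ R with hE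
      have hCR : (1 + ε) * C R ≤ 4 * (2 / κ) ^ R := by
        have h1 : C R ≤ 2 * (2 / κ) ^ R := by
          rw [div_pow, hC]
          have := mul_le_mul_of_nonneg_right (cc_le R) (show 0 ≤ (κ⁻¹) ^ R by positivity)
          refine this.trans (le_of_eq ?_)
          rw [inv_pow]; ring
        have h2 := hC0 R
        nlinarith
      have hE1 : 0 ≤ 4 * (2 / κ) ^ R := by positivity
      have term : ∀ i ∈ Finset.range (p + 1), phi ν (p - i) i ≤
          n * κ ^ p * ((1 + ε) * (C (p - i) + C i) + E) := by
        intro i hi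
        have hi' : i ≤ p := Nat.lt_succ_iff.1 (Finset.mem_range.1 hi)
        have hC1 : 0 ≤ (1 + ε) * C i := mul_nonneg (by positivity) (hC0 i)
        have hC2 : 0 ≤ (1 + ε) * C (p - i) := mul_nonneg (by positivity) (hC0 _)
        have hnk : 0 ≤ (n:ℝ) * κ ^ p := by positivity
        by_cases q1 : p - i ≤ R
        · refine (low (p - i) i q1 (by omega)).trans (mul_le_mul_of_nonneg_left ?_ hnk)
          linarith
        by_cases q2 : i ≤ R
        · rw [phi_symm]
          refine (low i (p - i) q2 (by omega)).trans (mul_le_mul_of_nonneg_left ?_ hnk)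
          linarith
        · have hS' : Even (p - R) := by
            obtain ⟨u, hu⟩ := hR; obtain ⟨v, hv⟩ := hpe'; exact ⟨v - u, by omega⟩
          refine (phi_mid h hR hS' (by omega) (by omega) (by omega)).trans ?_
          refine (low R (p - R) le_rfl (by omega)).trans (mul_le_mul_of_nonneg_left ?_ hnk)
          linarith
      rw [T_rec h p]
      refine (Finset.sum_le_sum term).trans ?_
      rw [← Finset.mul_sum, Finset.sum_add_distrib, ← Finset.mul_sum, Finset.sum_add_distrib]
      have s1 : ∑ i ∈ Finset.range (p + 1), C i ≤ S := hSκ (p + 1)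
      have s2 : ∑ i ∈ Finset.range (p + 1), C (p - i) ≤ S := by
        have e : ∑ i ∈ Finset.range (p + 1), C (p - i) =
            ∑ j ∈ Finset.range (p + 1), C (p + 1 - 1 - j) := by simp
        rw [e, Finset.sum_range_reflect]; exact hSκ (p + 1)
      simp only [Finset.sum_const, Finset.card_range, nsmul_eq_mul]
      have hE0 : 0 ≤ E := by positivity
      have h5 : ((p + 1 : ℕ) : ℝ) * E ≤ θ := by
        refine le_trans (mul_le_mul_of_nonneg_right ?_ hE0) c5
        push_cast; linarith
      have h6 : θ * B ≤ θ := mul_le_of_le_one_right hθ hB1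
      have fin : (1 + ε) * (∑ i ∈ Finset.range (p + 1), C (p - i) + ∑ i ∈ Finset.range (p + 1), C i) +
          ((p + 1 : ℕ) : ℝ) * E ≤ κ ^ 2 := by
        have : (1 + ε) * (∑ i ∈ Finset.range (p + 1), C (p - i) +
            ∑ i ∈ Finset.range (p + 1), C i) ≤ (1 + ε) * (S + S) := by gcongr
        nlinarith
      calc _ ≤ (n:ℝ) * κ ^ p * κ ^ 2 := mul_le_mul_of_nonneg_left fin (by positivity)
        _ = _ := by ring

theorem norm_mom {ν : Measure (MM n)} {ε G : ℝ} (h : GM ν ε) (hn : 1 ≤ n) (hG : 0 < G) {P : ℕ}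
    (hP : Even P) (hT : ∫ A, (A ^ P).trace ∂ν ≤ G ^ P) {a : ℕ} (ha : a ≤ P) :
    ∫ A, ‖A‖ ^ a ∂ν ≤ 2 * G ^ a := by
  have := h.gauss
  have pw : ∀ x : ℝ, 0 ≤ x → x ^ a ≤ G ^ a + G ^ a / G ^ P * x ^ P := by
    intro x hx
    have h2 : 0 ≤ G ^ a / G ^ P * x ^ P := by positivity
    rcases le_total x G with hxG | hxG
    · have := pow_le_pow_left₀ hx hxG a
      linarith
    · have h3 : x ^ a ≤ G ^ a / G ^ P * x ^ P := by
        rw [div_mul_eq_mul_div, le_div_iff₀ (by positivity)]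
        obtain ⟨k, rfl⟩ := Nat.exists_eq_add_of_le ha
        rw [pow_add, pow_add]
        have h4 := pow_le_pow_left₀ hG.le hxG k
        have : x ^ a * (G ^ a * G ^ k) ≤ x ^ a * (G ^ a * x ^ k) := by gcongr
        linarith
      have : 0 ≤ G ^ a := by positivity
      linarith
  have hm : ∫ A, ‖A‖ ^ P ∂ν ≤ G ^ P := by
    refine le_trans (integral_mono_ae ((PG.id.norm.pow P).integrable ν)
      ((PG.id.pow P).trace.integrable ν) ?_) hT
    filter_upwards [h.herm] with A hA using norm_pow_le_trace hA hn hP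
  calc ∫ A, ‖A‖ ^ a ∂ν ≤ ∫ A, (G ^ a + G ^ a / G ^ P * ‖A‖ ^ P) ∂ν :=
        integral_mono ((PG.id.norm.pow a).integrable ν)
          (((PG.const _).add ((PG.const _).mul (PG.id.norm.pow P))).integrable ν)
          fun A => pw _ (norm_nonneg _)
    _ = G ^ a + G ^ a / G ^ P * ∫ A, ‖A‖ ^ P ∂ν := by
        rw [integral_add (integrable_const _) (((PG.id.norm.pow P).integrable ν).const_mul _),
          integral_const_mul]
        simp
    _ ≤ G ^ a + G ^ a / G ^ P * G ^ P := by gcongr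
    _ = 2 * G ^ a := by field_simp; ring

/-- main non-asymptotic moment bound -/
theorem step3 {ν : Measure (MM n)} {ε w μ δ B θ : ℝ} (h : GM ν ε) (hn : 1 ≤ n)
    (hδ0 : 0 ≤ δ) (hδ : 24 * ε ≤ δ ^ 2) (hw : 1 < w) (hμ : 1 ≤ μ) {P R : ℕ} (hP : Even P)
    (hP0 : 0 < P)
    (hR : Even R) (hRP : 2 * R ≤ P) (hμP : (n:ℝ) < μ ^ P)
    (hθ : 4 * θ = w ^ 2 - (w⁻¹) ^ 2) (hB0 : 0 ≤ B) (hB1 : B ≤ 1) (hε1 : ε ≤ 1)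
    (c1 : 8 * ε ≤ θ * B) (c2 : 2 * B * R ≤ θ) (c3 : δ * R ^ 2 ≤ θ * B) (c4 : δ * R ≤ B)
    (c5 : (P + 1) * (3 * B * μ ^ R + 4 * (2 / (w + w⁻¹)) ^ R) ≤ θ) (c6 : 2 * ε * P ^ 2 ≤ 1 / 4) :
    ∫ A, (A ^ P).trace ∂ν ≤ n * (w + w⁻¹) ^ P ∧
    (∀ a ≤ P, ∫ A, ‖A‖ ^ a ∂ν ≤ 2 * (μ * (w + w⁻¹)) ^ a) ∧
    ∀ p ≤ R, ‖mp ν p - cc p • 1‖ ≤ B * (μ * (w + w⁻¹)) ^ p := by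
  have := h.gauss
  have hw0 : 0 < w := by linarith
  have hwi : w⁻¹ < 1 := inv_lt_one_of_one_lt₀ hw
  have hwi0 : 0 < w⁻¹ := inv_pos.2 hw0
  set Λ := w + w⁻¹ with hΛ
  have hww : w * w⁻¹ = 1 := mul_inv_cancel₀ hw0.ne'
  have hΛ2 : 2 ≤ Λ := by
    have : 0 ≤ (w - 1) ^ 2 * w⁻¹ := by positivity
    nlinarith
  have hΛ0 : 0 < Λ := by linarith
  have hθ0 : 0 ≤ θ := by nlinarith
  have hS2 : 1 + (w⁻¹) ^ 2 ≤ 2 := by nlinarith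
  have hΛS : 2 * (1 + (w⁻¹) ^ 2) + 4 * θ ≤ Λ ^ 2 := by rw [hθ, hΛ]; nlinarith
  have hμ0 : 0 < μ := by linarith
  have gen : ∀ κ, Λ ≤ κ → ∫ A, (A ^ P).trace ∂ν ≤ (μ * κ) ^ P →
      ∫ A, (A ^ P).trace ∂ν ≤ n * κ ^ P ∧
      (∀ a ≤ P, ∫ A, ‖A‖ ^ a ∂ν ≤ 2 * (μ * κ) ^ a) ∧
      ∀ p ≤ R, ‖mp ν p - cc p • 1‖ ≤ B * (μ * κ) ^ p := by
    intro κ hκ hT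
    have hκ0 : 0 < κ := by linarith
    have hG0 : 0 < μ * κ := by positivity
    have hGκ : κ ≤ μ * κ := le_mul_of_one_le_left hκ0.le hμ
    have hm : ∀ a ≤ P, ∫ A, ‖A‖ ^ a ∂ν ≤ 2 * (μ * κ) ^ a := fun a ha =>
      norm_mom h hn hG0 hP hT ha
    have hκS := hΛS.trans (pow_le_pow_left₀ hΛ0.le hκ 2)
    have c5' : (P + 1) * (3 * B * μ ^ R + 4 * (2 / κ) ^ R) ≤ θ := le_trans (by gcongr) c5
    refine ⟨?_, hm, ?_⟩
    · exact step2 h hn hδ0 hδ (by linarith) hμ hP hR hRP (fun t ht => hm _ ht)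
        (fun N => csum_w hw.le hκ N) (fun N => csum_w hw.le (hκ.trans hGκ) N) hS2 hκS hθ0 hB0 hB1
        hε1 c1 c2 c3 c4 c5' c6 P le_rfl hP
    · exact step1 h hδ0 hδ R (by linarith) (fun t ht => hm _ (by omega))
        (fun N => csum_w hw.le (hκ.trans hGκ) N) hS2
        (hκS.trans (pow_le_pow_left₀ hκ0.le hGκ 2)) hB0 hB1 hε1 c1 c2 c3
  set T := ∫ A, (A ^ P).trace ∂ν with hTd
  have hT0 : 0 ≤ T := integral_nonneg_of_ae (by
    filter_upwards [h.herm] with A hA using trace_even_nonneg hA hP)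
  have hTle : T ≤ (μ * Λ) ^ P := by
    by_contra hc
    push Not at hc
    have hP' : P ≠ 0 := hP0.ne'
    set κ := T ^ ((P:ℝ)⁻¹) / μ with hκ
    have hTp : (T ^ ((P:ℝ)⁻¹)) ^ P = T := Real.rpow_inv_natCast_pow hT0 hP'
    have e1 : (μ * κ) ^ P = T := by
      rw [hκ, mul_div_cancel₀ _ hμ0.ne', hTp]
    have hκ0 : 0 ≤ κ := by positivity
    have hΛκ : Λ ≤ κ := by
      have : (μ * Λ) ^ P < (μ * κ) ^ P := by rw [e1]; exact hc
      have h2 := lt_of_pow_lt_pow_left₀ P (by positivity) this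
      exact (lt_of_mul_lt_mul_left h2 hμ0.le).le
    have h3 := (gen κ hΛκ e1.ge).1
    rw [← e1, mul_pow] at h3
    have h4 : 0 < κ ^ P := by
      have : 0 < κ := by linarith
      positivity
    have := le_of_mul_le_mul_right h3 h4
    linarith
  exact gen Λ le_rfl hTle
end S3

end PartS3

section PartD
open MeasureTheory ProbabilityTheory Filter Topology
open scoped Matrix.Norms.L2Operator

section D
variable {n : ℕ} {Ω : Type*} [MeasureSpace Ω] [IsProbabilityMeasure (volume : Measure Ω)]

theorem meas_MM {Y : Ω → MM n} (hY : ∀ i j, Measurable fun ω => Y ω i j) : Measurable Y := by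
  have e : Y = fun ω => ∑ i, ∑ j, (Y ω i j) • (Matrix.single i j (1:ℝ) : MM n) := by
    funext ω
    conv_lhs => rw [Matrix.matrix_eq_sum_single (Y ω)]
    simp [Matrix.smul_single]
  rw [e]
  refine Finset.measurable_fun_sum _ fun i _ => Finset.measurable_fun_sum _ fun j _ => ?_
  exact (hY i j).smul_const _

theorem corr_bound {e : Fin n × Fin n → Fin n × Fin n → ℝ} {η : ℝ} (hη : 0 ≤ η)
    (h1 : ∀ p, e p p = 1) (h2 : ∀ p, e p p.swap = 1)
    (h3 : ∀ p q, ¬ (p = q ∨ p = q.swap) → |e p q| ≤ η) (p q : Fin n × Fin n) :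
    |e p q| ≤ (if q = p then 1 else 0) + (if q = p.swap then 1 else 0) + η ∧
    e p q ^ 2 ≤ (if q = p then 1 else 0) + (if q = p.swap then 1 else 0) + η ^ 2 := by
  by_cases c1 : q = p
  · subst c1
    rw [h1]
    have : (0:ℝ) ≤ if q = q.swap then 1 else 0 := by split_ifs <;> norm_num
    simp only [if_true]
    constructor
    · rw [abs_one]; linarith
    · nlinarith
  by_cases c2 : q = p.swap
  · subst c2
    rw [h2]
    simp only [if_true]
    have : (0:ℝ) ≤ if p.swap = p then 1 else 0 := by split_ifs <;> norm_num
    constructor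
    · rw [abs_one]; linarith
    · nlinarith
  · have := h3 p q (by
      rintro (rfl | rfl)
      · exact c1 rfl
      · exact c2 (by simp))
    rw [if_neg c1, if_neg c2]
    constructor
    · linarith
    · have := pow_le_pow_left₀ (abs_nonneg _) this 2
      rw [sq_abs] at this; linarith

theorem quad_bound (u : Fin n × Fin n → ℝ) (hu : ∀ p, 0 ≤ u p) {η : ℝ} (hη : 0 ≤ η) :
    ∑ p, ∑ q, u p * u q * ((if q = p then 1 else 0) + (if q = p.swap then 1 else 0) + η) ≤
      (2 + n ^ 2 * η) * ∑ p, u p ^ 2 := by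
  have e : ∀ p, ∑ q, u p * u q * ((if q = p then 1 else 0) + (if q = p.swap then 1 else 0) + η) =
      u p ^ 2 + u p * u p.swap + η * (u p * ∑ q, u q) := by
    intro p
    simp only [mul_add, Finset.sum_add_distrib, mul_ite, mul_one, mul_zero, Finset.sum_ite_eq',
      Finset.mem_univ, if_true]
    rw [Finset.mul_sum, Finset.mul_sum]
    congr 1
    · rw [sq]
    · exact Finset.sum_congr rfl fun q _ => by ring
  simp only [e, Finset.sum_add_distrib, ← Finset.mul_sum, ← Finset.sum_mul]
  have a1 : ∑ p : Fin n × Fin n, u p.swap ^ 2 = ∑ p, u p ^ 2 :=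
    Equiv.sum_comp (Equiv.prodComm (Fin n) (Fin n)) (fun p => u p ^ 2)
  have a2 : ∑ p : Fin n × Fin n, u p * u p.swap ≤ ∑ p, u p ^ 2 := by
    calc ∑ p : Fin n × Fin n, u p * u p.swap ≤ ∑ p : Fin n × Fin n, (u p ^ 2 + u p.swap ^ 2) / 2 :=
          Finset.sum_le_sum fun p _ => by nlinarith [sq_nonneg (u p - u p.swap)]
      _ = _ := by rw [← Finset.sum_div, Finset.sum_add_distrib, a1]; ring
  have a3 : (∑ p, u p) ^ 2 ≤ (n:ℝ) ^ 2 * ∑ p, u p ^ 2 := by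
    have := sq_sum_le_card_mul_sum_sq (s := Finset.univ) (f := u)
    simp only [Finset.card_univ, Fintype.card_prod, Fintype.card_fin] at this
    push_cast at this
    rw [sq (n:ℝ)]; exact this
  have a4 := mul_le_mul_of_nonneg_left a3 hη
  nlinarith

theorem GM_of (hn : 1 ≤ n) {X : Ω → MM n} (hsymm : ∀ ω, (X ω).IsSymm)
    (hg1 : ∀ i j, Measurable fun ω => X ω i j)
    (hg2 : ∀ c : Fin n × Fin n → ℝ, ∃ v : NNReal,
      Measure.map (fun ω => ∑ i, c i * X ω i.1 i.2) (volume : Measure Ω) = gaussianReal 0 v)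
    (hvar : ∀ i j, ∫ ω, (X ω i j) ^ 2 = 1) {η a : ℝ} (hη : 0 ≤ η) (hnη : n * η ≤ 1)
    (ha : a ^ 2 = 1 / n)
    (hcorr : ∀ i j i' j' : Fin n, ¬((i, j) = (i', j') ∨ (i, j) = (j', i')) →
      |∫ ω, X ω i j * X ω i' j'| ≤ η) :
    GM (Measure.map (fun ω => a • X ω) (volume : Measure Ω)) (2 / n + n * η) := by
  have hn0 : (0:ℝ) < n := by exact_mod_cast hn
  have hYm : Measurable (fun ω => a • X ω) :=
    meas_MM (fun i j => by simpa using (hg1 i j).const_mul a)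
  set ν := Measure.map (fun ω => a • X ω) (volume : Measure Ω) with hν
  have hprob : IsProbabilityMeasure ν := Measure.isProbabilityMeasure_map hYm.aemeasurable
  have hG : IsGaussian ν := by
    refine isGaussian_of_map_eq_gaussianReal fun Lf => ?_
    obtain ⟨v, hv⟩ := hg2 fun p => a * Lf (Matrix.single p.1 p.2 (1:ℝ))
    refine ⟨0, v, ?_⟩
    rw [hν, Measure.map_map Lf.continuous.measurable hYm, ← hv]
    congr 1
    funext ω
    simp only [Function.comp]
    conv_lhs => rw [Matrix.matrix_eq_sum_single (X ω)]
    rw [map_smul, map_sum, Fintype.sum_prod_type, smul_eq_mul, Finset.mul_sum]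
    refine Finset.sum_congr rfl fun i _ => ?_
    rw [map_sum, Finset.mul_sum]
    refine Finset.sum_congr rfl fun j _ => ?_
    have : (Matrix.single i j (X ω i j) : MM n) = X ω i j • Matrix.single i j (1:ℝ) := by
      simp [Matrix.smul_single]
    rw [this, map_smul, smul_eq_mul]; ring
  have tr : ∀ {f : MM n → ℝ}, PG f → ∫ A, f A ∂ν = ∫ ω, f (a • X ω) := fun hf =>
    integral_map hYm.aemeasurable hf.continuous.aestronglyMeasurable
  set e : Fin n × Fin n → Fin n × Fin n → ℝ :=
    fun p q => ∫ ω, X ω p.1 p.2 * X ω q.1 q.2 with he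
  have cov : ∀ i j k l : Fin n, ∫ B, B i j * B k l ∂ν = (1 / n) * e (i, j) (k, l) := by
    intro i j k l
    rw [tr ((PG.id.entry i j).mul (PG.id.entry k l)), ← ha, he, ← integral_const_mul]
    refine integral_congr_ae (Eventually.of_forall fun ω => ?_)
    simp only [Matrix.smul_apply, smul_eq_mul]; ring
  have e1 : ∀ p, e p p = 1 := fun p => by
    have := hvar p.1 p.2
    simp only [sq] at this; exact this
  have e2 : ∀ p, e p p.swap = 1 := fun p => by
    rw [← e1 p, he]
    refine integral_congr_ae (Eventually.of_forall fun ω => ?_)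
    simp only [Prod.fst_swap, Prod.snd_swap]
    rw [(hsymm ω).apply]
  have e3 : ∀ p q, ¬ (p = q ∨ p = q.swap) → |e p q| ≤ η := fun p q hpq =>
    hcorr p.1 p.2 q.1 q.2 hpq
  refine ⟨hG, ?_, ?_, by positivity, ?_, ?_, ?_⟩
  · ext i j
    have h1 : (∫ A, A ∂ν) i j = ∫ A, A i j ∂ν :=
      ((entL i j).integral_comp_comm (PG.id.integrable ν)).symm
    rw [h1, tr (PG.id.entry i j)]
    simp only [Matrix.smul_apply, smul_eq_mul, Matrix.zero_apply]
    rw [integral_const_mul]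
    obtain ⟨v, hv⟩ := hg2 (fun p => if p = (i, j) then 1 else 0)
    simp only [ite_mul, one_mul, zero_mul, Finset.sum_ite_eq', Finset.mem_univ, if_true] at hv
    have h2 : ∫ x, x ∂(gaussianReal 0 v) = 0 := integral_id_gaussianReal
    have h3 : ∫ x, x ∂(Measure.map (fun ω => X ω i j) (volume : Measure Ω)) = ∫ ω, X ω i j :=
      integral_map (hg1 i j).aemeasurable (f := fun x : ℝ => x) measurable_id.aestronglyMeasurable
    rw [← hv, h3] at h2
    rw [h2, mul_zero]
  · have hcl : IsClosed {A : MM n | A.IsHermitian} :=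
      isClosed_eq (continuous_id.matrix_conjTranspose) continuous_id
    rw [hν, ae_map_iff hYm.aemeasurable hcl.measurableSet]
    refine Eventually.of_forall fun ω => ?_
    have : (a • X ω).IsSymm := (hsymm ω).smul a
    rw [Matrix.IsHermitian, Matrix.conjTranspose_eq_transpose_of_trivial]; exact this
  · have ent : ∀ i l, |(KK ν 1 - 1) i l| ≤ η := by
      intro i l
      have h1 : KK ν 1 i l = ∑ k, (1 / (n:ℝ)) * e (i, k) (k, l) := by
        rw [KK_entry]
        simp only [Matrix.mul_one, Matrix.trace, Matrix.diag_apply, NN, Matrix.of_apply, cov]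
      rw [Matrix.sub_apply, h1]
      by_cases hil : i = l
      · subst hil
        have : ∀ k, e (i, k) (k, i) = 1 := fun k => e2 (i, k)
        simp only [this, Matrix.one_apply_eq]
        simp [hn0.ne', hη]
      · rw [Matrix.one_apply_ne hil, sub_zero]
        have : ∀ k, |(1 / (n:ℝ)) * e (i, k) (k, l)| ≤ (1 / (n:ℝ)) * η := by
          intro k
          rw [abs_mul, abs_of_nonneg (by positivity : (0:ℝ) ≤ 1 / n)]
          refine mul_le_mul_of_nonneg_left (e3 _ _ ?_) (by positivity)
          simp only [Prod.mk.injEq, Prod.swap_prod_mk]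
          rintro (⟨h, h'⟩ | ⟨h, -⟩)
          · exact hil (h.trans h')
          · exact hil h
        refine (Finset.abs_sum_le_sum_abs _ _).trans ((Finset.sum_le_sum fun k _ => this k).trans ?_)
        simp; field_simp; exact le_rfl
    have h2 : ‖KK ν 1 - 1‖ ^ 2 ≤ (n * η) ^ 2 := by
      refine (norm_sq_le_frob _).trans ?_
      unfold frob
      calc ∑ i, ∑ j, (KK ν 1 - 1) i j ^ 2 ≤ ∑ i : Fin n, ∑ j : Fin n, η ^ 2 :=
            Finset.sum_le_sum fun i _ => Finset.sum_le_sum fun j _ => by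
              have := pow_le_pow_left₀ (abs_nonneg _) (ent i j) 2
              rwa [sq_abs] at this
        _ = _ := by simp; ring
    have h3 := (abs_le_of_sq_le_sq' h2 (by positivity)).2
    have : 0 ≤ 2 / (n:ℝ) := by positivity
    linarith
  · intro W
    set u : Fin n × Fin n → ℝ := fun p => |W p.2 p.1| with hu
    have t1 : ∀ B : MM n, (B * W).trace ^ 2 =
        ∑ p : Fin n × Fin n, ∑ q : Fin n × Fin n, W p.2 p.1 * W q.2 q.1 * (B p.1 p.2 * B q.1 q.2) := by
      intro B
      have : (B * W).trace = ∑ p : Fin n × Fin n, B p.1 p.2 * W p.2 p.1 := by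
        rw [Fintype.sum_prod_type]; simp [Matrix.trace, Matrix.mul_apply]
      rw [this, sq, Finset.sum_mul_sum]
      exact Finset.sum_congr rfl fun p _ => Finset.sum_congr rfl fun q _ => by ring
    have t2 : ∫ B, (B * W).trace ^ 2 ∂ν = ∑ p : Fin n × Fin n, ∑ q : Fin n × Fin n,
        W p.2 p.1 * W q.2 q.1 * ((1 / n) * e p q) := by
      simp only [t1]
      have ii : ∀ p q : Fin n × Fin n, Integrable (fun B : MM n =>
          W p.2 p.1 * W q.2 q.1 * (B p.1 p.2 * B q.1 q.2)) ν := fun p q =>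
        (((PG.id.entry p.1 p.2).mul (PG.id.entry q.1 q.2)).integrable ν).const_mul _
      rw [integral_finsetSum _ fun p _ => integrable_finsetSum _ fun q _ => ii p q]
      refine Finset.sum_congr rfl fun p _ => ?_
      rw [integral_finsetSum _ fun q _ => ii p q]
      refine Finset.sum_congr rfl fun q _ => ?_
      rw [integral_const_mul, cov]
    have t3 := quad_bound u (fun p => abs_nonneg _) hη
    have t4 : ∑ p, u p ^ 2 = frob W := by
      rw [Fintype.sum_prod_type, Finset.sum_comm]
      simp [hu, frob]
    rw [t4] at t3
    rw [t2]
    calc _ ≤ ∑ p : Fin n × Fin n, ∑ q : Fin n × Fin n, (1 / (n:ℝ)) * (u p * u q *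
          ((if q = p then 1 else 0) + (if q = p.swap then 1 else 0) + η)) := by
          refine Finset.sum_le_sum fun p _ => Finset.sum_le_sum fun q _ => ?_
          refine (le_abs_self _).trans ?_
          rw [abs_mul, abs_mul, abs_mul, abs_of_nonneg (by positivity : (0:ℝ) ≤ 1 / n)]
          have := (corr_bound hη e1 e2 e3 p q).1
          have h5 : 0 ≤ (1 / (n:ℝ)) * (|W p.2 p.1| * |W q.2 q.1|) := by positivity
          have := mul_le_mul_of_nonneg_left this h5
          simp only [hu]
          linarith
      _ = (1 / (n:ℝ)) * ∑ p, ∑ q, u p * u q *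
          ((if q = p then 1 else 0) + (if q = p.swap then 1 else 0) + η) := by
          simp only [Finset.mul_sum]
      _ ≤ (1 / (n:ℝ)) * ((2 + n ^ 2 * η) * frob W) := mul_le_mul_of_nonneg_left t3 (by positivity)
      _ = _ := by field_simp
  · have hh : ∑ i : Fin n, ∑ j : Fin n, ∑ k : Fin n, ∑ l : Fin n, (∫ B, B i j * B k l ∂ν) ^ 2 =
        ∑ p : Fin n × Fin n, ∑ q : Fin n × Fin n, (1 / (n:ℝ)) ^ 2 * e p q ^ 2 := by
      simp only [cov, Fintype.sum_prod_type, mul_pow]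
    rw [hh]
    simp only [← Finset.mul_sum]
    have : ∑ p, ∑ q, e p q ^ 2 ≤ 2 * (n:ℝ) ^ 2 + n ^ 4 * η ^ 2 := by
      calc _ ≤ ∑ p : Fin n × Fin n, ∑ q : Fin n × Fin n,
            (((if q = p then 1 else 0) + (if q = p.swap then 1 else 0) + η ^ 2) : ℝ) :=
            Finset.sum_le_sum fun p _ => Finset.sum_le_sum fun q _ => (corr_bound hη e1 e2 e3 p q).2
        _ = _ := by
          simp only [Finset.sum_add_distrib, Finset.sum_ite_eq', Finset.mem_univ, if_true]
          simp; ring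
    have h6 : (n * η) ^ 2 ≤ 1 := pow_le_one₀ (by positivity) hnη
    calc _ ≤ (1 / (n:ℝ)) ^ 2 * (2 * (n:ℝ) ^ 2 + n ^ 4 * η ^ 2) :=
          mul_le_mul_of_nonneg_left this (by positivity)
      _ = 2 + (n * η) ^ 2 := by field_simp
      _ ≤ 3 := by linarith
end D

end PartD

section PartE1
open MeasureTheory ProbabilityTheory Filter Topology
open scoped Matrix.Norms.L2Operator

theorem GM.mono {n : ℕ} {ν : Measure (MM n)} {ε ε' : ℝ} (h : GM ν ε) (hle : ε ≤ ε') : GM ν ε' :=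
  ⟨h.gauss, h.mean, h.herm, h.eps.trans hle, h.h1.trans hle,
    fun W => (h.h2 W).trans (mul_le_mul_of_nonneg_right hle (frob_nonneg W)), h.h3⟩

set_option maxHeartbeats 2000000 in
theorem params {w θ K : ℝ} (hw : 1 < w) (hθ : 4 * θ = w ^ 2 - (w⁻¹) ^ 2) (hK : 0 ≤ K) (A0 : ℝ)
    (r0 : ℕ) : ∀ᶠ z : ℝ in atTop, ∃ (P R : ℕ) (μ δ : ℝ), 1 ≤ z ∧ 0 ≤ δ ∧
      24 * (K / z ^ 32) ≤ δ ^ 2 ∧ 1 ≤ μ ∧ μ ≤ 2 ∧ Even P ∧ 0 < P ∧ Even R ∧ 2 * R ≤ P ∧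
      Real.exp (z ^ 8) < μ ^ P ∧ K / z ^ 32 ≤ 1 ∧ 8 * (K / z ^ 32) ≤ θ * (1 / z ^ 12) ∧
      2 * (1 / z ^ 12) * R ≤ θ ∧ δ * R ^ 2 ≤ θ * (1 / z ^ 12) ∧ δ * R ≤ 1 / z ^ 12 ∧
      (P + 1) * (3 * (1 / z ^ 12) * μ ^ R + 4 * (2 / (w + w⁻¹)) ^ R) ≤ θ ∧
      2 * (K / z ^ 32) * P ^ 2 ≤ 1 / 4 ∧ r0 ≤ R ∧ 2 * A0 * z ^ 8 ≤ P := by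
  have hw0 : 0 < w := by linarith
  have hwi0 : 0 < w⁻¹ := inv_pos.2 hw0
  have hwi : w⁻¹ < 1 := inv_lt_one_of_one_lt₀ hw
  have hww : w * w⁻¹ = 1 := mul_inv_cancel₀ hw0.ne'
  have hΛ2 : 2 < w + w⁻¹ := by
    have : 0 < (w - 1) ^ 2 * w⁻¹ := mul_pos (pow_pos (by linarith) 2) hwi0
    nlinarith
  have hθ0 : 0 < θ := by nlinarith
  set Λ := w + w⁻¹
  set g := Real.log (Λ / 2) with hg
  have hg0 : 0 < g := Real.log_pos (by rw [lt_div_iff₀ two_pos]; linarith)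
  set a := 1 / g with ha
  have ha0 : 0 < a := by positivity
  have hag : a * g = 1 := by rw [ha]; field_simp
  set m := min (Real.log 2) (1 / (8 * a)) with hm
  have hm0 : 0 < m := lt_min (Real.log_pos one_lt_two) (by positivity)
  have hma : m * a ≤ 1 / 8 := by
    have : m ≤ 1 / (8 * a) := min_le_right _ _
    calc m * a ≤ 1 / (8 * a) * a := mul_le_mul_of_nonneg_right this ha0.le
      _ = 1 / 8 := by field_simp
  set A := max (max A0 1) (1 / m) with hA
  have hA1 : 1 ≤ A := (le_max_right _ _).trans (le_max_left _ _)
  have hA00 : A0 ≤ A := (le_max_left _ _).trans (le_max_left _ _)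
  have hAm : 1 ≤ m * A := by
    have : 1 / m ≤ A := le_max_right _ _
    rw [div_le_iff₀ hm0] at this; linarith
  set c := 2 * A + 2 with hc
  set E := Real.exp (2 * m) with hE
  set D := Real.sqrt (24 * K) with hD
  have hD0 : 0 ≤ D := Real.sqrt_nonneg _
  have hD2 : D ^ 2 = 24 * K := Real.sq_sqrt (by positivity)
  have hE0 : 0 < E := Real.exp_pos _
  have l1 : ∀ᶠ z : ℝ in atTop, 2 * (a * (8 * Real.log z) + 1) ≤ z := by
    have h1 : Tendsto (fun z : ℝ => Real.log z / z) atTop (𝓝 0) := by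
      simpa using Real.isLittleO_log_id_atTop.tendsto_div_nhds_zero
    have h2 := h1.eventually (gt_mem_nhds (show (0:ℝ) < 1 / (32 * a) by positivity))
    filter_upwards [h2, eventually_ge_atTop 4] with z hz hz4
    rw [div_lt_iff₀ (by linarith), div_mul_eq_mul_div, lt_div_iff₀ (by positivity)] at hz
    nlinarith
  have l2 : ∀ᶠ z : ℝ in atTop, (r0 : ℝ) ≤ 2 * (a * (8 * Real.log z)) := by
    have : Tendsto (fun z : ℝ => 2 * (a * (8 * Real.log z))) atTop atTop :=
      ((Real.tendsto_log_atTop.const_mul_atTop (by norm_num)).const_mul_atTop ha0).const_mul_atTop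
        two_pos
    exact this.eventually_ge_atTop _
  filter_upwards [l1, l2, eventually_ge_atTop 1, eventually_ge_atTop (8 * K / θ),
    eventually_ge_atTop (2 / θ), eventually_ge_atTop (D / θ), eventually_ge_atTop D,
    eventually_ge_atTop ((c + 1) * (3 * E + 4) / θ), eventually_ge_atTop (8 * K * c ^ 2),
    eventually_ge_atTop K] with z hz1 hz2 hz hk1 hk2 hk3 hk4 hk5 hk6 hk7
  have hz0 : 0 < z := by linarith
  have zp : ∀ k : ℕ, 1 ≤ k → z ≤ z ^ k := fun k hk => le_self_pow₀ hz (by omega)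
  rw [div_le_iff₀ hθ0] at hk1 hk2 hk3 hk5
  set l := 8 * Real.log z with hl
  have hl0 : 0 ≤ l := mul_nonneg (by norm_num) (Real.log_nonneg hz)
  set R := 2 * ⌈a * l⌉₊ with hR
  set P := 2 * ⌈A * z ^ 8⌉₊ with hP
  have hR1 : 2 * (a * l) ≤ R := by
    have := Nat.le_ceil (a * l); rw [hR]; push_cast; linarith
  have hR2 : (R:ℝ) ≤ 2 * (a * l + 1) := by
    have := (Nat.ceil_lt_add_one (show 0 ≤ a * l by positivity)).le
    rw [hR]; push_cast; linarith
  have hRz : (R:ℝ) ≤ z := hR2.trans hz1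
  have hR0 : (0:ℝ) ≤ R := Nat.cast_nonneg _
  have hP1 : 2 * (A * z ^ 8) ≤ P := by
    have := Nat.le_ceil (A * z ^ 8); rw [hP]; push_cast; linarith
  have hz8 : 1 ≤ z ^ 8 := one_le_pow₀ hz
  have hP2 : (P:ℝ) ≤ c * z ^ 8 := by
    have := (Nat.ceil_lt_add_one (show 0 ≤ A * z ^ 8 by positivity)).le
    rw [hP, hc]; push_cast; linarith
  have hP0 : (0:ℝ) < P := by nlinarith
  have hexpl : ∀ k : ℕ, Real.exp (k * Real.log z) = z ^ k := fun k => by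
    rw [Real.exp_nat_mul, Real.exp_log hz0]
  have hμR : Real.exp m ^ R ≤ E * z ^ 2 := by
    rw [← Real.exp_nat_mul, ← hexpl 2, hE, ← Real.exp_add]
    refine Real.exp_le_exp.2 ?_
    push_cast
    have h1 : R * m ≤ 2 * (a * l + 1) * m := mul_le_mul_of_nonneg_right hR2 hm0.le
    have h2 : m * a * l ≤ 1 / 8 * l := mul_le_mul_of_nonneg_right hma hl0
    rw [hl] at h2 h1
    nlinarith
  have hΛR : (2 / Λ) ^ R ≤ 1 / z ^ 16 := by
    have e1 : 2 / Λ = Real.exp (-g) := by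
      rw [Real.exp_neg, hg, Real.exp_log (by positivity), inv_div]
    rw [e1, ← Real.exp_nat_mul, one_div, ← hexpl 16, ← Real.exp_neg]
    refine Real.exp_le_exp.2 ?_
    have h1 : 2 * (a * l) * g ≤ R * g := mul_le_mul_of_nonneg_right hR1 hg0.le
    have h2 : 2 * (a * l) * g = 2 * l := by
      calc _ = 2 * l * (a * g) := by ring
        _ = _ := by rw [hag, mul_one]
    rw [h2, hl] at h1
    push_cast
    linarith
  refine ⟨P, R, Real.exp m, D / z ^ 16, hz, by positivity, ?_, Real.one_le_exp hm0.le, ?_,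
    even_two_mul _, by exact_mod_cast hP0, even_two_mul _, ?_, ?_, ?_, ?_, ?_, ?_, ?_, ?_, ?_, ?_, ?_⟩
  · rw [div_pow, hD2]; apply le_of_eq; field_simp
  · calc Real.exp m ≤ Real.exp (Real.log 2) := Real.exp_le_exp.2 (min_le_left _ _)
      _ = 2 := Real.exp_log two_pos
  · have : (2:ℝ) * R ≤ P := by
      have h1 := zp 8 (by norm_num)
      have : z ^ 8 ≤ A * z ^ 8 := le_mul_of_one_le_left (by positivity) hA1
      linarith
    exact_mod_cast this
  · rw [← Real.exp_nat_mul]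
    refine Real.exp_lt_exp.2 ?_
    have h1 : 2 * (A * z ^ 8) * m ≤ P * m := mul_le_mul_of_nonneg_right hP1 hm0.le
    have h2 : 1 * z ^ 8 ≤ m * A * z ^ 8 := mul_le_mul_of_nonneg_right hAm (by positivity)
    nlinarith
  · rw [div_le_one (by positivity)]; exact hk7.trans (zp 32 (by norm_num))
  · have e : 8 * (K / z ^ 32) = 8 * K * (1 / z ^ 32) := by ring
    have h1 : 8 * K ≤ θ * z ^ 20 := by
      have := mul_le_mul_of_nonneg_left (zp 20 (by norm_num)) hθ0.le; linarith
    calc 8 * (K / z ^ 32) = 8 * K * (1 / z ^ 32) := by ring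
      _ ≤ θ * z ^ 20 * (1 / z ^ 32) := mul_le_mul_of_nonneg_right h1 (by positivity)
      _ = _ := by field_simp
  · calc 2 * (1 / z ^ 12) * R ≤ 2 * (1 / z ^ 12) * z := by gcongr
      _ = 2 / z ^ 11 := by field_simp
      _ ≤ θ := by
        rw [div_le_iff₀ (by positivity)]
        have := mul_le_mul_of_nonneg_left (zp 11 (by norm_num)) hθ0.le; linarith
  · calc D / z ^ 16 * R ^ 2 ≤ D / z ^ 16 * z ^ 2 := by gcongr
      _ = D * (1 / z ^ 14) := by field_simp
      _ ≤ θ * z ^ 2 * (1 / z ^ 14) := by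
        refine mul_le_mul_of_nonneg_right ?_ (by positivity)
        have := mul_le_mul_of_nonneg_left (zp 2 (by norm_num)) hθ0.le; linarith
      _ = _ := by field_simp
  · calc D / z ^ 16 * R ≤ D / z ^ 16 * z := by gcongr
      _ = D * (1 / z ^ 15) := by field_simp
      _ ≤ z ^ 3 * (1 / z ^ 15) := by
        refine mul_le_mul_of_nonneg_right ?_ (by positivity)
        have := zp 3 (by norm_num); linarith
      _ = _ := by field_simp
  · have hc0 : 0 < c := by positivity
    calc (P + 1) * (3 * (1 / z ^ 12) * Real.exp m ^ R + 4 * (2 / Λ) ^ R)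
        ≤ (c * z ^ 8 + z ^ 8) * (3 * (1 / z ^ 12) * (E * z ^ 2) + 4 * (1 / z ^ 16)) := by gcongr
      _ = (c + 1) * (3 * E * (1 / z ^ 2) + 4 * (1 / z ^ 8)) := by field_simp
      _ ≤ (c + 1) * (3 * E * (1 / z ^ 2) + 4 * (1 / z ^ 2)) := by
        gcongr
        norm_num
      _ = (c + 1) * (3 * E + 4) / z ^ 2 := by ring
      _ ≤ θ := by
        rw [div_le_iff₀ (by positivity)]
        have := mul_le_mul_of_nonneg_left (zp 2 (by norm_num)) hθ0.le; linarith
  · calc 2 * (K / z ^ 32) * P ^ 2 ≤ 2 * (K / z ^ 32) * (c * z ^ 8) ^ 2 := by gcongr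
      _ = 8 * K * c ^ 2 / z ^ 16 / 4 := by field_simp; ring
      _ ≤ 1 / 4 := by
        gcongr
        rw [div_le_one (by positivity)]
        exact hk6.trans (zp 16 (by norm_num))
  · have : (r0:ℝ) ≤ R := hz2.trans hR1
    exact_mod_cast this
  · refine le_trans ?_ hP1
    have := mul_le_mul_of_nonneg_right hA00 (show 0 ≤ z ^ 8 by positivity)
    linarith

theorem main_bound {w K : ℝ} (hw : 1 < w) (hK : 0 ≤ K) (A0 : ℝ) (r0 : ℕ) :
    ∀ᶠ n : ℕ in atTop, ∀ ν : Measure (MM n), GM ν (K / Real.log n ^ 4) →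
      ∃ P : ℕ, Even P ∧ r0 ≤ P ∧ 2 * A0 * Real.log n ≤ P ∧
        ∫ A, (A ^ P).trace ∂ν ≤ n * (w + w⁻¹) ^ P ∧
        (∀ a ≤ P, ∫ A, ‖A‖ ^ a ∂ν ≤ 2 * (2 * (w + w⁻¹)) ^ a) ∧
        ∀ p ≤ r0, ‖mp ν p - cc p • 1‖ ≤ (Real.log n)⁻¹ * (2 * (w + w⁻¹)) ^ p := by
  have hlog : Tendsto (fun n : ℕ => Real.log n) atTop atTop :=
    Real.tendsto_log_atTop.comp tendsto_natCast_atTop_atTop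
  have hz : Tendsto (fun n : ℕ => (Real.log n) ^ ((8:ℝ)⁻¹)) atTop atTop :=
    (tendsto_rpow_atTop (by norm_num)).comp hlog
  have ev := hz.eventually (params hw (θ := (w ^ 2 - (w⁻¹) ^ 2) / 4) (by ring) hK A0 r0)
  filter_upwards [ev, eventually_ge_atTop 1, hlog.eventually_ge_atTop 1] with n hn hn1 hl ν hν
  obtain ⟨P, R, μ, δ, q1, q2, q3, q4, q5, q6, q7, q8, q9, q10, q11, q12, q13, q14, q15, q16, q17,
    q18, q19⟩ := hn
  set z := (Real.log n) ^ ((8:ℝ)⁻¹) with hzd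
  have hz8 : z ^ 8 = Real.log n := by
    have := Real.rpow_inv_natCast_pow (n := 8) (show 0 ≤ Real.log n by linarith) (by norm_num)
    exact_mod_cast this
  have hz32 : z ^ 32 = Real.log n ^ 4 := by rw [← hz8]; ring
  have hz0 : 0 < z := by linarith
  have hw0 : 0 < w := by linarith
  have hn0 : (0:ℝ) < n := by exact_mod_cast hn1
  rw [hz8, Real.exp_log hn0] at q10
  rw [← hz32] at hν
  obtain ⟨r1, r2, r3⟩ := step3 hν hn1 q2 q3 hw q4 q6 q7 q8 q9 q10
    (θ := (w ^ 2 - (w⁻¹) ^ 2) / 4) (by ring) (B := 1 / z ^ 12) (by positivity)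
    ((div_le_one (by positivity)).2 (one_le_pow₀ q1)) q11 q12 q13 q14 q15 q16 q17
  have hΛ0 : 0 < w + w⁻¹ := by positivity
  have hμ0 : 0 < μ := by linarith
  refine ⟨P, q6, by omega, by rw [hz8] at q19; exact q19, r1, ?_, ?_⟩
  · intro a ha
    refine (r2 a ha).trans ?_
    gcongr
  · intro p hp
    refine (r3 p (by omega)).trans ?_
    rw [← hz8, one_div]
    gcongr
    norm_num

end PartE1

section PartE2
open MeasureTheory ProbabilityTheory Filter Topology
open scoped Matrix.Norms.L2Operator

section E2
variable {Ω : Type*} [MeasureSpace Ω] [IsProbabilityMeasure (volume : Measure Ω)]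

theorem bc {s : ℕ → Set Ω} {b : ℕ → ℝ} (hb : Summable b)
    (h : ∀ᶠ n in atTop, (volume : Measure Ω).real (s n) ≤ b n) :
    ∀ᵐ ω ∂(volume : Measure Ω), ∀ᶠ n in atTop, ω ∉ s n := by
  obtain ⟨N, hN⟩ := eventually_atTop.1 h
  have hs : ∑' n, (volume : Measure Ω) (s (n + N)) ≠ ⊤ := by
    have hb' : Summable fun n => b (n + N) := (summable_nat_add_iff N).2 hb
    refine ne_top_of_le_ne_top hb'.tsum_ofReal_ne_top (ENNReal.tsum_le_tsum fun n => ?_)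
    have := hN (n + N) (by omega)
    rw [← ofReal_measureReal]
    exact ENNReal.ofReal_le_ofReal this
  filter_upwards [ae_eventually_notMem hs] with ω hω
  obtain ⟨M, hM⟩ := eventually_atTop.1 hω
  refine eventually_atTop.2 ⟨M + N, fun n hn => ?_⟩
  have := hM (n - N) (by omega)
  rwa [Nat.sub_add_cancel (by omega)] at this

theorem log_summable : Summable fun n : ℕ => 1 / ((n:ℝ) * (1 + Real.log n) ^ 2) := by
  have hl : ∀ n : ℕ, 0 ≤ Real.log n := fun n => Real.log_natCast_nonneg n
  rw [← summable_condensed_iff_of_nonneg]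
  · have h2 : 0 < Real.log 2 := Real.log_pos one_lt_two
    have base : Summable fun k : ℕ => (1 / Real.log 2 ^ 2) * (1 / ((k:ℝ) + 1) ^ 2) := by
      refine Summable.mul_left _ ?_
      have := (summable_nat_add_iff 1).2 (Real.summable_one_div_nat_pow.2 one_lt_two)
      refine this.congr fun k => by push_cast; rfl
    refine Summable.of_nonneg_of_le (fun k => by have := hl (2 ^ k); positivity) (fun k => ?_) base
    have hlog : Real.log ((2 ^ k : ℕ) : ℝ) = k * Real.log 2 := by push_cast; rw [Real.log_pow]
    rw [hlog]
    have hle : Real.log 2 ≤ 1 := by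
      have := Real.log_two_lt_d9; linarith
    have e : (2:ℝ) ^ k * (1 / (((2 ^ k : ℕ) : ℝ) * (1 + k * Real.log 2) ^ 2)) =
        1 / (1 + k * Real.log 2) ^ 2 := by push_cast; field_simp
    rw [e]
    have e2 : (1 / Real.log 2 ^ 2) * (1 / ((k:ℝ) + 1) ^ 2) = 1 / (Real.log 2 * (k + 1)) ^ 2 := by
      field_simp
    rw [e2]
    have hk : (0:ℝ) ≤ k := Nat.cast_nonneg k
    gcongr
    nlinarith
  · intro n; have := hl n; positivity
  · intro m n hm hmn
    have h1 : (m:ℝ) ≤ n := by exact_mod_cast hmn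
    have h0 : (0:ℝ) < m := by exact_mod_cast hm
    have := hl m
    have h2 : Real.log m ≤ Real.log n := Real.log_le_log h0 h1
    gcongr

theorem upper_as {Y : (n : ℕ) → Ω → MM n} (hY : ∀ n, Measurable (Y n)) {K : ℝ} (hK : 0 ≤ K)
    (hGM : ∀ᶠ n : ℕ in atTop, GM (Measure.map (Y n) (volume : Measure Ω)) (K / Real.log n ^ 4))
    {ρ : ℝ} (hρ : 0 < ρ) :
    ∀ᵐ ω ∂(volume : Measure Ω), ∀ᶠ n : ℕ in atTop, ‖Y n ω‖ ≤ 2 + ρ := by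
  set s := Real.sqrt (ρ / 2) with hs
  have hs0 : 0 < s := Real.sqrt_pos.2 (by positivity)
  have hs2 : s ^ 2 = ρ / 2 := Real.sq_sqrt (by positivity)
  set w := 1 + s with hw
  have hw1 : 1 < w := by linarith
  have hw0 : 0 < w := by linarith
  have hΛ : w + w⁻¹ ≤ 2 + ρ / 2 := by
    have : w⁻¹ ≤ 1 - s + s ^ 2 := by
      rw [inv_le_iff_one_le_mul₀ hw0, hw]; nlinarith [pow_pos hs0 3]
    linarith
  set Λ := w + w⁻¹ with hΛd
  have hΛ0 : 0 < Λ := by positivity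
  set Λ' := 2 + ρ with hΛ'
  have hΛ'0 : 0 < Λ' := by positivity
  set g := Real.log (Λ' / Λ) with hg
  have hg0 : 0 < g := Real.log_pos (by rw [lt_div_iff₀ hΛ0]; linarith)
  have hb : Summable fun n : ℕ => 1 / (n:ℝ) ^ 2 := Real.summable_one_div_nat_pow.2 one_lt_two
  have key := bc (Ω := Ω) (s := fun n => Y n ⁻¹' {A | Λ' ≤ ‖A‖}) hb (by
    filter_upwards [hGM, main_bound hw1 hK (3 / (2 * g)) 0, eventually_ge_atTop 1] with n h1 h2 hn
    obtain ⟨P, p1, -, p3, p4, -, -⟩ := h2 _ h1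
    have hgs := h1.gauss
    set ν := Measure.map (Y n) (volume : Measure Ω) with hν
    have hmeas : MeasurableSet {A : MM n | Λ' ≤ ‖A‖} :=
      (isClosed_le continuous_const continuous_norm).measurableSet
    rw [← map_measureReal_apply (hY n) hmeas, ← hν]
    have hn0 : (0:ℝ) < n := by exact_mod_cast hn
    have mk := mul_meas_ge_le_integral_of_nonneg (μ := ν) (f := fun A : MM n => ‖A‖ ^ P)
      (Eventually.of_forall fun A => by positivity) ((PG.id.norm.pow P).integrable ν) (Λ' ^ P)
    have hm : ∫ A, ‖A‖ ^ P ∂ν ≤ n * Λ ^ P := by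
      refine le_trans (integral_mono_ae ((PG.id.norm.pow P).integrable ν)
        ((PG.id.pow P).trace.integrable ν) ?_) p4
      filter_upwards [h1.herm] with A hA using norm_pow_le_trace hA hn p1
    have sub : ν.real {A : MM n | Λ' ≤ ‖A‖} ≤ ν.real {A : MM n | Λ' ^ P ≤ ‖A‖ ^ P} :=
      measureReal_mono fun A hA => pow_le_pow_left₀ hΛ'0.le hA P
    have e1 : Λ ^ P / Λ' ^ P ≤ 1 / (n:ℝ) ^ 3 := by
      have : Λ ^ P / Λ' ^ P = Real.exp (-(P * g)) := by
        rw [Real.exp_neg, Real.exp_nat_mul, hg, Real.exp_log (by positivity), ← div_pow, ← inv_pow,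
          inv_div]
      have e2 : 1 / (n:ℝ) ^ 3 = Real.exp (-((3:ℕ) * Real.log n)) := by
        rw [Real.exp_neg, Real.exp_nat_mul, Real.exp_log hn0, one_div]
      rw [this, e2]
      refine Real.exp_le_exp.2 (neg_le_neg ?_)
      have := mul_le_mul_of_nonneg_right p3 hg0.le
      have e3 : 2 * (3 / (2 * g)) * Real.log n * g = 3 * Real.log n := by field_simp
      push_cast; linarith
    have hpos : 0 < Λ' ^ P := by positivity
    have h5 : ν.real {A : MM n | Λ' ≤ ‖A‖} ≤ n * (Λ ^ P / Λ' ^ P) := by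
      rw [← mul_div_assoc, le_div_iff₀ hpos, mul_comm]
      exact (mul_le_mul_of_nonneg_left sub hpos.le).trans (mk.trans hm)
    refine h5.trans ((mul_le_mul_of_nonneg_left e1 hn0.le).trans (le_of_eq ?_))
    field_simp)
  filter_upwards [key] with ω hω
  filter_upwards [hω] with n hn
  have : ¬ (Λ' ≤ ‖Y n ω‖) := hn
  linarith [not_le.1 this]

theorem abs_trace_le {n : ℕ} (M : MM n) : |M.trace| ≤ n * ‖M‖ := by
  calc |M.trace| ≤ ∑ i, |M i i| := Finset.abs_sum_le_sum_abs _ _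
    _ ≤ ∑ i : Fin n, ‖M‖ := Finset.sum_le_sum fun i _ => entry_le M i i
    _ = _ := by simp

theorem moments_as {Y : (n : ℕ) → Ω → MM n} (hY : ∀ n, Measurable (Y n)) {K : ℝ} (hK : 0 ≤ K)
    (hGM : ∀ᶠ n : ℕ in atTop, GM (Measure.map (Y n) (volume : Measure Ω)) (K / Real.log n ^ 4))
    (p : ℕ) :
    ∀ᵐ ω ∂(volume : Measure Ω),
      Tendsto (fun n : ℕ => (1 / (n:ℝ)) * (Y n ω ^ p).trace) atTop (𝓝 (cc p)) := by
  have hlog : Tendsto (fun n : ℕ => Real.log n) atTop atTop :=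
    Real.tendsto_log_atTop.comp tendsto_natCast_atTop_atTop
  set m : ℕ → ℝ := fun n => ∫ A, (A ^ p).trace ∂(Measure.map (Y n) (volume : Measure Ω)) with hm
  set Λ : ℝ := 2 * (2 + (2:ℝ)⁻¹)
  have hΛ0 : 0 < Λ := by positivity
  have mb := main_bound (w := 2) one_lt_two hK 0 (2 * p)
  have hmean : Tendsto (fun n : ℕ => (1 / (n:ℝ)) * m n) atTop (𝓝 (cc p)) := by
    have hb : Tendsto (fun n : ℕ => (Real.log n)⁻¹ * Λ ^ p) atTop (𝓝 0) := by
      simpa using hlog.inv_tendsto_atTop.mul_const (Λ ^ p)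
    rw [tendsto_iff_dist_tendsto_zero]
    refine squeeze_zero' (Eventually.of_forall fun n => dist_nonneg) ?_ hb
    filter_upwards [hGM, mb, eventually_ge_atTop 1] with n h1 h2 hn
    obtain ⟨P, -, -, -, -, -, p6⟩ := h2 _ h1
    have hgs := h1.gauss
    set ν := Measure.map (Y n) (volume : Measure Ω) with hν
    have hn0 : (0:ℝ) < n := by exact_mod_cast hn
    have e1 : m n = (mp ν p).trace := trL.integral_comp_comm ((PG.id.pow p).integrable ν)
    have e2 : (1 / (n:ℝ)) * m n - cc p = (1 / (n:ℝ)) * (mp ν p - cc p • 1).trace := by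
      rw [e1, Matrix.trace_sub, Matrix.trace_smul, Matrix.trace_one]
      simp; field_simp
    rw [Real.dist_eq, e2, abs_mul, abs_of_nonneg (by positivity : (0:ℝ) ≤ 1 / n)]
    calc 1 / (n:ℝ) * |(mp ν p - cc p • 1).trace| ≤ 1 / (n:ℝ) * (n * ‖mp ν p - cc p • 1‖) :=
          mul_le_mul_of_nonneg_left (abs_trace_le _) (by positivity)
      _ = ‖mp ν p - cc p • 1‖ := by field_simp
      _ ≤ _ := p6 p (by omega)
  have fl : ∀ k : ℕ, ∀ᵐ ω ∂(volume : Measure Ω), ∀ᶠ n : ℕ in atTop,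
      ¬ ((1 / ((k:ℝ) + 1)) ≤ |(1 / (n:ℝ)) * ((Y n ω ^ p).trace - m n)|) := by
    intro k
    set ρ := 1 / ((k:ℝ) + 1)
    have hρ : 0 < ρ := by positivity
    set Q : ℝ := (1 / ρ ^ 2) * (2 * K * p ^ 2 * (2 * Λ ^ (2 * (p - 1)))) * 4 with hQ
    have hQ0 : 0 ≤ Q := by positivity
    refine bc (Ω := Ω) (s := fun n => Y n ⁻¹' {A | ρ ≤ |(1 / (n:ℝ)) * ((A ^ p).trace - m n)|})
      (log_summable.mul_left Q) ?_
    filter_upwards [hGM, mb, eventually_ge_atTop 1, hlog.eventually_ge_atTop 1] with n h1 h2 hn hl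
    obtain ⟨P, -, p2, -, -, p5, -⟩ := h2 _ h1
    have hgs := h1.gauss
    set ν := Measure.map (Y n) (volume : Measure Ω) with hν
    have hn0 : (0:ℝ) < n := by exact_mod_cast hn
    have pgT : PG (fun A : MM n => (1 / (n:ℝ)) * ((A ^ p).trace - m n)) :=
      (PG.const _).mul ((PG.id.pow p).trace.sub (PG.const _))
    have hmeas : MeasurableSet {A : MM n | ρ ≤ |(1 / (n:ℝ)) * ((A ^ p).trace - m n)|} :=
      (isClosed_le continuous_const pgT.continuous.abs).measurableSet
    rw [← map_measureReal_apply (hY n) hmeas, ← hν]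
    have mk := mul_meas_ge_le_integral_of_nonneg (μ := ν)
      (f := fun A : MM n => ((1 / (n:ℝ)) * ((A ^ p).trace - m n)) ^ 2)
      (Eventually.of_forall fun A => by positivity) ((pgT.pow 2).integrable ν) (ρ ^ 2)
    have sub : ν.real {A : MM n | ρ ≤ |(1 / (n:ℝ)) * ((A ^ p).trace - m n)|} ≤
        ν.real {A : MM n | ρ ^ 2 ≤ ((1 / (n:ℝ)) * ((A ^ p).trace - m n)) ^ 2} :=
      measureReal_mono fun A hA => by
        have := pow_le_pow_left₀ hρ.le hA 2
        rwa [sq_abs] at this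
    have hv : ∫ A, ((1 / (n:ℝ)) * ((A ^ p).trace - m n)) ^ 2 ∂ν ≤
        (1 / (n:ℝ)) * ((K / Real.log n ^ 4) * (2 * p ^ 2 * (2 * Λ ^ (2 * (p - 1))))) := by
      simp only [mul_pow]
      rw [integral_const_mul]
      have v := var_trace_one h1 p
      have t : ∫ A, (A ^ (2 * (p - 1))).trace ∂ν ≤ n * (2 * Λ ^ (2 * (p - 1))) := by
        calc ∫ A, (A ^ (2 * (p - 1))).trace ∂ν ≤ ∫ A, n * ‖A‖ ^ (2 * (p - 1)) ∂ν := by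
              refine integral_mono_ae ((PG.id.pow _).trace.integrable ν)
                (((PG.const _).mul (PG.id.norm.pow _)).integrable ν) ?_
              filter_upwards [h1.herm] with A hA
              exact (le_abs_self _).trans (abs_trace_pow_le hA _)
          _ = n * ∫ A, ‖A‖ ^ (2 * (p - 1)) ∂ν := integral_const_mul _ _
          _ ≤ _ := mul_le_mul_of_nonneg_left (p5 _ (by omega)) hn0.le
      have v2 := v.trans (mul_le_mul_of_nonneg_left t
        (show 0 ≤ 2 * (K / Real.log n ^ 4) * (p:ℝ) ^ 2 by positivity))
      have v3 := mul_le_mul_of_nonneg_left v2 (show 0 ≤ (1 / (n:ℝ)) ^ 2 by positivity)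
      refine v3.trans (le_of_eq ?_)
      field_simp
    have h6 : ν.real {A : MM n | ρ ≤ |(1 / (n:ℝ)) * ((A ^ p).trace - m n)|} ≤ (1 / ρ ^ 2) *
        ((1 / (n:ℝ)) * ((K / Real.log n ^ 4) * (2 * p ^ 2 * (2 * Λ ^ (2 * (p - 1)))))) := by
      rw [one_div_mul_eq_div, le_div_iff₀ (by positivity), mul_comm]
      exact (mul_le_mul_of_nonneg_left sub (by positivity)).trans (mk.trans hv)
    have h7 : 1 / Real.log n ^ 4 ≤ 4 * (1 / (1 + Real.log n) ^ 2) := by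
      rw [mul_one_div, div_le_div_iff₀ (by positivity) (by positivity)]
      nlinarith [pow_le_pow_right₀ hl (show 2 ≤ 4 by norm_num)]
    refine h6.trans ?_
    have h8 := mul_le_mul_of_nonneg_left h7
      (show 0 ≤ (1 / ρ ^ 2) * (2 * K * p ^ 2 * (2 * Λ ^ (2 * (p - 1)))) * (1 / n) by positivity)
    calc _ = (1 / ρ ^ 2) * (2 * K * p ^ 2 * (2 * Λ ^ (2 * (p - 1)))) * (1 / n) *
            (1 / Real.log n ^ 4) := by ring
      _ ≤ _ := h8
      _ = _ := by rw [hQ, one_div_mul_eq_div]; field_simp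
  filter_upwards [ae_all_iff.2 fl] with ω hω
  have hfl : Tendsto (fun n : ℕ => (1 / (n:ℝ)) * ((Y n ω ^ p).trace - m n)) atTop (𝓝 0) := by
    rw [Metric.tendsto_atTop']
    intro e he
    obtain ⟨k, hk⟩ := exists_nat_one_div_lt he
    obtain ⟨N, hN⟩ := eventually_atTop.1 (hω k)
    refine ⟨N, fun n hn => ?_⟩
    rw [Real.dist_eq, sub_zero]
    exact (not_le.1 (hN n hn.le)).trans hk
  have := hfl.add hmean
  rw [zero_add] at this
  refine this.congr fun n => by ring
end E2

end PartE2

section PartF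
open MeasureTheory ProbabilityTheory Filter Topology
open scoped Matrix.Norms.L2Operator

theorem cc_odd_even (k : ℕ) : cc (2 * k + 1) = 0 ∧ cc (2 * k) = (catalan k : ℝ) := by
  induction k using Nat.strong_induction_on with
  | _ k ih =>
    rcases k with _ | k
    · simp [cc_one, cc_zero]
    have hodd : ∀ i, i < 2 * k + 2 → i % 2 = 1 → cc i = 0 := by
      intro i hi hm
      have := (ih (i / 2) (by omega)).1
      rwa [show 2 * (i / 2) + 1 = i by omega] at this
    constructor
    · rw [show 2 * (k + 1) + 1 = (2 * k + 1) + 2 by ring, cc_rec]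
      refine Finset.sum_eq_zero fun i hi => ?_
      rw [Finset.mem_range] at hi
      rcases Nat.mod_two_eq_zero_or_one i with h | h
      · rw [hodd (2 * k + 1 - i) (by omega) (by omega), zero_mul]
      · rw [hodd i (by omega) h, mul_zero]
    · rw [show 2 * (k + 1) = 2 * k + 2 by ring, cc_rec, catalan_succ, Nat.cast_sum]
      have key : ∀ m, ∑ i ∈ Finset.range (2 * m + 1), (if i % 2 = 1 then 0 else cc (2 * k - i) * cc i)
          = ∑ i ∈ Finset.range (m + 1), cc (2 * k - 2 * i) * cc (2 * i) := by
        intro m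
        induction m with
        | zero => simp
        | succ m ihm =>
          rw [show 2 * (m + 1) + 1 = 2 * m + 1 + 1 + 1 by ring, Finset.sum_range_succ,
            Finset.sum_range_succ, ihm, Finset.sum_range_succ _ (m + 1)]
          rw [if_pos (by omega), if_neg (by omega)]
          simp [show 2 * m + 1 + 1 = 2 * (m + 1) by ring]
      have e1 : ∑ i ∈ Finset.range (2 * k + 1), cc (2 * k - i) * cc i =
          ∑ i ∈ Finset.range (2 * k + 1), (if i % 2 = 1 then 0 else cc (2 * k - i) * cc i) := by
        refine Finset.sum_congr rfl fun i hi => ?_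
        rw [Finset.mem_range] at hi
        split_ifs with h
        · rw [hodd i (by omega) h, mul_zero]
        · rfl
      rw [e1, key, Finset.sum_range]
      refine Finset.sum_congr rfl fun i _ => ?_
      have hi := i.2
      rw [← Nat.mul_sub, (ih (k - i) (by omega)).2, (ih i (by omega)).2, Nat.cast_mul, mul_comm]

theorem cc_lower (k : ℕ) : (4:ℝ) ^ (k + 1) ≤ 2 * (k + 1) * (k + 2) * cc (2 * k + 2) := by
  have h1 := Nat.four_pow_le_two_mul_self_mul_centralBinom (k + 1) (by omega)
  have h2 := succ_mul_catalan_eq_centralBinom (k + 1)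
  have h3 := (cc_odd_even (k + 1)).2
  rw [show 2 * k + 2 = 2 * (k + 1) by ring, h3]
  rw [← h2] at h1
  have h4 : ((4 ^ (k + 1) : ℕ) : ℝ) ≤ _ := Nat.cast_le.2 h1
  push_cast at h4
  nlinarith [h4]

theorem no_bound {q : ℝ} (hq0 : 0 ≤ q) (hq : q < 2) : ∃ k : ℕ, 6 * q ^ (2 * k + 1) < cc (2 * k + 2) := by
  by_contra! h
  have hr0 : 0 ≤ q ^ 2 / 4 := by positivity
  have hr : q ^ 2 / 4 < 1 := by nlinarith
  have t2 := tendsto_pow_const_mul_const_pow_of_lt_one 2 hr0 hr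
  have t1 := tendsto_pow_const_mul_const_pow_of_lt_one 1 hr0 hr
  have t0 := tendsto_pow_const_mul_const_pow_of_lt_one 0 hr0 hr
  have T := (((t2.const_mul 1).add (t1.const_mul 3)).add (t0.const_mul 2)).const_mul (3 * q)
  simp only [mul_zero, add_zero] at T
  obtain ⟨k, hk⟩ := (T.eventually (gt_mem_nhds (show (0:ℝ) < 1 by norm_num))).exists
  have hl := cc_lower k
  have hh := h k
  have e : 3 * q * (1 * ((k:ℝ) ^ 2 * (q ^ 2 / 4) ^ k) + 3 * ((k:ℝ) ^ 1 * (q ^ 2 / 4) ^ k) +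
      2 * ((k:ℝ) ^ 0 * (q ^ 2 / 4) ^ k)) * 4 ^ (k + 1) =
      2 * (k + 1) * (k + 2) * (6 * q ^ (2 * k + 1)) := by
    rw [div_pow, ← pow_mul, pow_succ 4, pow_succ q]
    field_simp
    ring
  have hpos : (0:ℝ) < 4 ^ (k + 1) := by positivity
  have h5 := mul_lt_mul_of_pos_right hk hpos
  rw [e, one_mul] at h5
  have h6 : 2 * ((k:ℝ) + 1) * (k + 2) * cc (2 * k + 2) ≤ 2 * (k + 1) * (k + 2) * (6 * q ^ (2 * k + 1)) := by
    gcongr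
  linarith

theorem pt_bound {x q : ℝ} (hq0 : 0 ≤ q) (hx : x ≤ q) (hx3 : |x| ≤ 3) (k : ℕ) :
    x ^ (2 * k + 2) + 3 * x ^ (2 * k + 1) ≤ 6 * q ^ (2 * k + 1) := by
  have hqp : 0 ≤ q ^ (2 * k + 1) := by positivity
  have e : x ^ (2 * k + 2) = x * x ^ (2 * k + 1) := by ring
  obtain ⟨ha, hb⟩ := abs_le.1 hx3
  rw [e]
  rcases le_total 0 x with h | h
  · have h1 : x ^ (2 * k + 1) ≤ q ^ (2 * k + 1) := pow_le_pow_left₀ h hx _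
    have h2 : 0 ≤ x ^ (2 * k + 1) := by positivity
    nlinarith
  · have h2 : x ^ (2 * k + 1) ≤ 0 := Odd.pow_nonpos ⟨k, rfl⟩ h
    nlinarith

theorem lower_det {A : ∀ n, MM n} (hA : ∀ n, (A n).IsHermitian)
    (hm : ∀ p, Tendsto (fun n : ℕ => (1 / (n:ℝ)) * (A n ^ p).trace) atTop (𝓝 (cc p)))
    (hb : ∀ᶠ n in atTop, ‖A n‖ ≤ 3) {q : ℝ} (hq : q < 2) :
    ∀ᶠ n in atTop, ∃ i, q < (hA n).eigenvalues i := by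
  wlog hq0 : 0 ≤ q generalizing q
  · filter_upwards [this (q := 0) (by norm_num) le_rfl] with n ⟨i, hi⟩
    exact ⟨i, by linarith⟩
  obtain ⟨k, hk⟩ := no_bound hq0 hq
  have T := (hm (2 * k + 2)).add ((hm (2 * k + 1)).const_mul 3)
  rw [(cc_odd_even k).1, mul_zero, add_zero] at T
  filter_upwards [T.eventually (lt_mem_nhds hk), hb, eventually_ge_atTop 1] with n h1 h2 hn
  by_contra! hc
  have hn' : (0:ℝ) < n := by exact_mod_cast hn
  have key : (A n ^ (2 * k + 2)).trace + 3 * (A n ^ (2 * k + 1)).trace ≤ n * (6 * q ^ (2 * k + 1)) := by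
    rw [trace_pow_eq (hA n), trace_pow_eq (hA n), Finset.mul_sum, ← Finset.sum_add_distrib]
    calc _ ≤ ∑ i : Fin n, 6 * q ^ (2 * k + 1) :=
          Finset.sum_le_sum fun i _ => pt_bound hq0 (hc i) ((abs_eig_le (hA n) i).trans h2) k
      _ = _ := by simp
  have e : 1 / (n:ℝ) * (A n ^ (2 * k + 2)).trace + 3 * (1 / (n:ℝ) * (A n ^ (2 * k + 1)).trace) =
      (1 / n) * ((A n ^ (2 * k + 2)).trace + 3 * (A n ^ (2 * k + 1)).trace) := by ring
  rw [e] at h1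
  have : (1 / (n:ℝ)) * ((A n ^ (2 * k + 2)).trace + 3 * (A n ^ (2 * k + 1)).trace) ≤
      (1 / n) * (n * (6 * q ^ (2 * k + 1))) := by gcongr
  rw [← mul_assoc, one_div_mul_cancel hn'.ne', one_mul] at this
  linarith

noncomputable def lamx {n : ℕ} (A : Matrix (Fin n) (Fin n) ℝ) : ℝ :=
  sSup {t : ℝ | ∃ v : Fin n → ℝ, v ≠ 0 ∧ A.mulVec v = t • v}

theorem eig_le_norm {n : ℕ} (A : MM n) {t : ℝ} {v : Fin n → ℝ} (hv : v ≠ 0)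
    (h : A.mulVec v = t • v) : t ≤ ‖A‖ := by
  have h1 := mulVec_sq_le A v
  rw [h] at h1
  simp only [Pi.smul_apply, smul_eq_mul, mul_pow, ← Finset.mul_sum] at h1
  have hpos : 0 < ∑ i, v i ^ 2 := by
    obtain ⟨i, hi⟩ := Function.ne_iff.1 hv
    refine Finset.sum_pos' (fun j _ => sq_nonneg _) ⟨i, Finset.mem_univ _, ?_⟩
    have : v i ≠ 0 := hi
    positivity
  have h2 := le_of_mul_le_mul_right h1 hpos
  exact (le_abs_self t).trans (abs_le_of_sq_le_sq h2 (norm_nonneg _))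

theorem eig_mem {n : ℕ} {A : MM n} (hA : A.IsHermitian) (i : Fin n) :
    hA.eigenvalues i ∈ {t : ℝ | ∃ v : Fin n → ℝ, v ≠ 0 ∧ A.mulVec v = t • v} := by
  refine ⟨_, ?_, hA.mulVec_eigenvectorBasis i⟩
  have := hA.eigenvectorBasis.orthonormal.ne_zero i
  intro h
  exact this (by ext j; exact congrFun h j)

theorem eig_le_lamx {n : ℕ} {A : MM n} (hA : A.IsHermitian) (i : Fin n) :
    hA.eigenvalues i ≤ lamx A :=
  le_csSup ⟨‖A‖, fun _ ⟨_, hv, h⟩ => eig_le_norm A hv h⟩ (eig_mem hA i)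

theorem lamx_le {n : ℕ} {A : MM n} (hA : A.IsHermitian) (i : Fin n) : lamx A ≤ ‖A‖ :=
  csSup_le ⟨_, eig_mem hA i⟩ fun _ ⟨_, hv, h⟩ => eig_le_norm A hv h

end PartF

section PartH
open MeasureTheory ProbabilityTheory Filter Topology
open scoped Matrix.Norms.L2Operator

theorem final_thm
    {Ω : Type*} [MeasureSpace Ω] [IsProbabilityMeasure (volume : Measure Ω)]
    (X : (n : ℕ) → Ω → Matrix (Fin n) (Fin n) ℝ)
    (hsymm : ∀ n ω, (X n ω).IsSymm)
    (hg1 : ∀ n, ∀ p : Fin n × Fin n, Measurable fun ω => X n ω p.1 p.2)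
    (hg2 : ∀ n, ∀ c : Fin n × Fin n → ℝ, ∃ v : NNReal,
      Measure.map (fun ω => ∑ i, c i * X n ω i.1 i.2) (volume : Measure Ω) = gaussianReal 0 v)
    (hvar : ∀ n, ∀ i j : Fin n, ∫ ω, (X n ω i j) ^ 2 = 1)
    (τ C : ℝ) (hτ : 4 < τ) (hC : 0 < C)
    (hcorr : ∀ n : ℕ, 2 ≤ n → ∀ i j i' j' : Fin n,
      ¬((i, j) = (i', j') ∨ (i, j) = (j', i')) →
      |∫ ω, X n ω i j * X n ω i' j'| ≤ C / ((n : ℝ) * Real.log n ^ τ)) :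
    ∀ᵐ ω ∂(volume : Measure Ω),
      Tendsto (fun n : ℕ => lamx (((n : ℝ) ^ (-(1 / 2) : ℝ)) • X n ω)) atTop (𝓝 2) := by
  set Y : (n : ℕ) → Ω → MM n := fun n ω => ((n : ℝ) ^ (-(1 / 2) : ℝ)) • X n ω with hY
  have hlog : Tendsto (fun n : ℕ => Real.log n) atTop atTop :=
    Real.tendsto_log_atTop.comp tendsto_natCast_atTop_atTop
  have hmeas : ∀ n, Measurable (Y n) := by
    intro n
    refine meas_MM fun i j => ?_
    exact (hg1 n (i, j)).const_mul _
  have hH : ∀ n ω, (Y n ω).IsHermitian := by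
    intro n ω
    have := (hsymm n ω).smul ((n : ℝ) ^ (-(1 / 2) : ℝ))
    rw [Matrix.IsHermitian, Matrix.conjTranspose_eq_transpose_of_trivial]
    exact this
  have hGM : ∀ᶠ n : ℕ in atTop, GM (Measure.map (Y n) volume) ((2 + C) / Real.log n ^ 4) := by
    have hlo : ∀ᶠ n : ℕ in atTop, Real.log n ^ 4 ≤ (n:ℝ) := by
      have h := (Real.isLittleO_pow_log_id_atTop (n := 4)).bound (show (0:ℝ) < 1 by norm_num)
      have h' := tendsto_natCast_atTop_atTop.eventually h
      filter_upwards [h'] with n hn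
      simp only [id, one_mul, Real.norm_eq_abs] at hn
      exact (le_abs_self _).trans (hn.trans (by rw [Nat.abs_cast]))
    filter_upwards [hlo, hlog.eventually_ge_atTop 1, hlog.eventually_ge_atTop C, eventually_ge_atTop 2]
      with n h1 h2 h3 hn
    have hn0 : (0:ℝ) < n := by exact_mod_cast (by omega : 0 < n)
    set l := Real.log n with hl
    have hl0 : 0 < l := by linarith
    have hτ4 : l ^ 4 ≤ l ^ τ := by
      rw [← Real.rpow_natCast]
      exact Real.rpow_le_rpow_of_exponent_le h2 (by push_cast; linarith)
    have hl4 : l ≤ l ^ 4 := le_self_pow₀ h2 (by norm_num)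
    have hτ0 : 0 < l ^ τ := Real.rpow_pos_of_pos hl0 _
    have e : (n:ℝ) * (C / (n * l ^ τ)) = C / l ^ τ := by field_simp
    have G := GM_of (by omega : 1 ≤ n) (hsymm n) (fun i j => hg1 n (i, j)) (hg2 n) (hvar n)
      (η := C / (n * l ^ τ)) (a := (n : ℝ) ^ (-(1 / 2) : ℝ)) (by positivity)
      (by rw [e, div_le_one hτ0]; linarith)
      (by
        rw [← Real.rpow_natCast, ← Real.rpow_mul hn0.le]
        norm_num
        rw [Real.rpow_neg_one])
      (hcorr n hn)
    refine G.mono ?_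
    rw [e, add_div]
    gcongr
  have hup : ∀ᵐ ω ∂(volume : Measure Ω), ∀ k : ℕ, ∀ᶠ n in atTop, ‖Y n ω‖ ≤ 2 + 1 / ((k:ℝ) + 1) := by
    rw [ae_all_iff]
    intro k
    exact upper_as hmeas (by positivity) hGM (by positivity)
  have hmo : ∀ᵐ ω ∂(volume : Measure Ω), ∀ p : ℕ,
      Tendsto (fun n : ℕ => (1 / (n:ℝ)) * (Y n ω ^ p).trace) atTop (𝓝 (cc p)) := by
    rw [ae_all_iff]
    intro p
    exact moments_as hmeas (by positivity) hGM p
  filter_upwards [hup, hmo] with ω h1 h2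
  refine tendsto_order.2 ⟨fun q hq => ?_, fun q hq => ?_⟩
  · have hb : ∀ᶠ n in atTop, ‖Y n ω‖ ≤ 3 := by
      filter_upwards [h1 0] with n hn
      norm_num at hn
      exact hn
    filter_upwards [lower_det (fun n => hH n ω) h2 hb hq] with n ⟨i, hi⟩
    exact hi.trans_le (eig_le_lamx (hH n ω) i)
  · obtain ⟨k, hk⟩ := exists_nat_one_div_lt (sub_pos.2 hq)
    filter_upwards [h1 k, eventually_ge_atTop 1] with n hn hn1
    have := lamx_le (hH n ω) ⟨0, hn1⟩
    have h : lamx (Y n ω) < q := by linarith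
    exact h

end PartH

end Aux

/-- centered Gaussian symmetric matrices with unit variances whose pairwise
correlations are bounded by `C / (n (log n)^τ)` for some `τ > 4`: the largest eigenvalue of
`n^{-1/2} X_n` converges to `2` almost surely. -/
theorem largest_eigenvalue_tendsto_two_log_decay
    {Ω : Type*} [MeasureSpace Ω] [IsProbabilityMeasure (volume : Measure Ω)]
    (X : (n : ℕ) → Ω → Matrix (Fin n) (Fin n) ℝ)
    (hsymm : ∀ n ω, (X n ω).IsSymm)
    (hgauss : ∀ n, IsCenteredGaussianVec fun p : Fin n × Fin n => fun ω => X n ω p.1 p.2)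
    (hvar : ∀ n, ∀ i j : Fin n, ∫ ω, (X n ω i j) ^ 2 = 1)
    (τ C : ℝ) (hτ : 4 < τ) (hC : 0 < C)
    (hcorr : ∀ n : ℕ, 2 ≤ n → ∀ i j i' j' : Fin n,
      ¬((i, j) = (i', j') ∨ (i, j) = (j', i')) →
      |∫ ω, X n ω i j * X n ω i' j'| ≤ C / ((n : ℝ) * Real.log n ^ τ)) :
    ∀ᵐ ω ∂(volume : Measure Ω),
      Tendsto (fun n : ℕ => lam1 (((n : ℝ) ^ (-(1 / 2) : ℝ)) • X n ω)) atTop (𝓝 2) := by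
  exact final_thm X hsymm (fun n => (hgauss n).1) (fun n => (hgauss n).2) hvar τ C hτ hC hcorr
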